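/- arXiv:1612.02615 — 3 statements merged into one kernel-verified Lean document; each statement's English description precedes it below -/
import Mathlib

section
/- Let a₁, a₂, a₃ > 0 and β ∈ [0, π], and let (ω_b, ω_t) be a gap of Σ(β) of type (ii). Then F_β(ω) → 0 as ω → ω_t from the left with ω ∈ (ω_b, ω_t), and limsup_{ω → ω_b⁺, ω ∈ (ω_b, ω_t)} (1 − F_β(ω)) ≤ 0. -/
open Real MeasureTheory Set Filter Topology

noncomputable section

/-- The dispersion relation `D_β(ω, k₁, k₂)`. -/
def Dfun (a₁ a₂ a₃ β ω k₁ k₂ : ℝ) : ℝ :=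
  Real.sin (ω * a₂) * Real.sin (ω * a₃) * (Real.cos (ω * a₁) - Real.cos k₁)
    + Real.sin (ω * a₃) * Real.sin (ω * a₁) * (Real.cos (ω * a₂) - Real.cos k₂)
    + Real.sin (ω * a₁) * Real.sin (ω * a₂) * (Real.cos (ω * a₃) - Real.cos β)

/-- The dispersion set `Σ(β)`. -/
def dispSet (a₁ a₂ a₃ β : ℝ) : Set ℝ :=
  {ω | 0 < ω ∧ ∃ k₁ ∈ Icc (0 : ℝ) π, ∃ k₂ ∈ Icc (0 : ℝ) π, Dfun a₁ a₂ a₃ β ω k₁ k₂ = 0}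

/-- `φ_β(ω) = (cos(ω a₃) − cos β)/sin(ω a₃)`. -/
def phiB (a₃ β ω : ℝ) : ℝ := (Real.cos (ω * a₃) - Real.cos β) / Real.sin (ω * a₃)

/-- `f(ξ, η, ω)`. -/
def fFun (a₁ a₂ ξ η ω : ℝ) : ℝ :=
  (Real.cos ξ - Real.cos (ω * a₁)) / Real.sin (ω * a₁)
    + (Real.cos η - Real.cos (ω * a₂)) / Real.sin (ω * a₂)

/-- `g_β(ω)`. -/
def gB (a₁ a₂ a₃ β ω : ℝ) : ℝ :=
  Real.cos (ω * a₁) / Real.sin (ω * a₁) + Real.cos (ω * a₂) / Real.sin (ω * a₂)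
    + phiB a₃ β ω

/-- The set `T = {πn/a₁ : n ≥ 1} ∪ {πn/a₂ : n ≥ 1}`. -/
def Tset (a₁ a₂ : ℝ) : Set ℝ :=
  {x | ∃ n : ℕ, 1 ≤ n ∧ x = π * n / a₁} ∪ {x | ∃ n : ℕ, 1 ≤ n ∧ x = π * n / a₂}

/-- The set `𝒲(β)`. -/
def Wset (a₃ β : ℝ) : Set ℝ :=
  if β = 0 ∨ β = π then
    {x | ∃ n : ℕ, 1 ≤ n ∧ x = β / a₃ + (2 * n + 1) * π / a₃}
  else
    {x | ∃ n : ℕ, 1 ≤ n ∧ x = π * n / a₃}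

/-- `(ω_b, ω_t)` is a gap of the dispersion set `Σ(β)`. -/
def IsGap (a₁ a₂ a₃ β ωb ωt : ℝ) : Prop :=
  0 < ωb ∧ ωb < ωt ∧ ωb ∈ dispSet a₁ a₂ a₃ β ∧ ωt ∈ dispSet a₁ a₂ a₃ β ∧
    Ioo ωb ωt ∩ dispSet a₁ a₂ a₃ β = ∅

/-- The finite-difference system (FD). -/
def SatisfiesFD (a₁ a₂ a₃ β μ ω : ℝ) (u : ℤ × ℤ → ℂ) : Prop :=
  (∀ k ℓ : ℤ, (k, ℓ) ≠ ((0 : ℤ), (0 : ℤ)) →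
    u (k + 1, ℓ) / (Real.sin (ω * a₁) : ℂ) + u (k - 1, ℓ) / (Real.sin (ω * a₁) : ℂ)
      + u (k, ℓ + 1) / (Real.sin (ω * a₂) : ℂ) + u (k, ℓ - 1) / (Real.sin (ω * a₂) : ℂ)
      - 2 * (gB a₁ a₂ a₃ β ω : ℂ) * u (k, ℓ) = 0)
  ∧ u (1, 0) / (Real.sin (ω * a₁) : ℂ) + u (-1, 0) / (Real.sin (ω * a₁) : ℂ)
      + u (0, 1) / (Real.sin (ω * a₂) : ℂ) + u (0, -1) / (Real.sin (ω * a₂) : ℂ)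
      - 2 * (gB a₁ a₂ a₃ β ω : ℂ) * u (0, 0)
      = 2 * ((μ - 1 : ℝ) : ℂ) * (phiB a₃ β ω : ℂ) * u (0, 0)

/-- `I_β(ω) = (1/(4π²)) ∫_{(0,2π)²} φ_β(ω)/(φ_β(ω) − f(ξ,η,ω)) dξ dη`. -/
def IB (a₁ a₂ a₃ β ω : ℝ) : ℝ :=
  (1 / (4 * π ^ 2)) *
    ∫ p in (Ioo (0 : ℝ) (2 * π)) ×ˢ (Ioo (0 : ℝ) (2 * π)),
      phiB a₃ β ω / (phiB a₃ β ω - fFun a₁ a₂ p.1 p.2 ω)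

/-- `F_β(ω) = I_β(ω)⁻¹`. -/
def FB (a₁ a₂ a₃ β ω : ℝ) : ℝ := (IB a₁ a₂ a₃ β ω)⁻¹

lemma Dfun_eq_mul {a₁ a₂ a₃ β ω : ℝ} (k₁ k₂ : ℝ) (h₁ : Real.sin (ω * a₁) ≠ 0)
    (h₂ : Real.sin (ω * a₂) ≠ 0) (h₃ : Real.sin (ω * a₃) ≠ 0) :
    Dfun a₁ a₂ a₃ β ω k₁ k₂ = Real.sin (ω * a₁) * Real.sin (ω * a₂) * Real.sin (ω * a₃) *
      (phiB a₃ β ω - fFun a₁ a₂ k₁ k₂ ω) := by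
  unfold Dfun phiB fFun
  field_simp
  ring

lemma continuous_fFun (a₁ a₂ ω : ℝ) :
    Continuous fun p : ℝ × ℝ => fFun a₁ a₂ p.1 p.2 ω := by
  unfold fFun
  fun_prop

lemma continuousAt_fFun {a₁ a₂ ω : ℝ} (ξ η : ℝ) (h₁ : Real.sin (ω * a₁) ≠ 0)
    (h₂ : Real.sin (ω * a₂) ≠ 0) : ContinuousAt (fun x => fFun a₁ a₂ ξ η x) ω := by
  unfold fFun
  fun_prop (disch := assumption)

lemma fFun_self (a₁ a₂ ω : ℝ) : fFun a₁ a₂ (ω * a₁) (ω * a₂) ω = 0 := by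
  simp [fFun]

lemma sin_ne_zero_of_notMem_dispSet {a₁ a₂ a₃ β ω : ℝ} (hω : 0 < ω)
    (h : ω ∉ dispSet a₁ a₂ a₃ β) : Real.sin (ω * a₁) ≠ 0 ∧ Real.sin (ω * a₂) ≠ 0 := by
  have hD : Dfun a₁ a₂ a₃ β ω (arccos (Real.cos (ω * a₁))) (arccos (Real.cos (ω * a₂))) ≠ 0 :=
    fun h0 => h ⟨hω, _, ⟨arccos_nonneg _, arccos_le_pi _⟩, _,
      ⟨arccos_nonneg _, arccos_le_pi _⟩, h0⟩
  simp only [Dfun, Real.cos_arccos (Real.neg_one_le_cos _) (Real.cos_le_one _), sub_self,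
    mul_zero, zero_add] at hD
  constructor <;> intro h0 <;> simp [h0] at hD

lemma fFun_lt_or_lt_of_notMem_dispSet {a₁ a₂ a₃ β ω : ℝ} (hω : 0 < ω)
    (h : ω ∉ dispSet a₁ a₂ a₃ β) (h₃ : Real.sin (ω * a₃) ≠ 0) :
    (∀ ξ η, fFun a₁ a₂ ξ η ω < phiB a₃ β ω) ∨ (∀ ξ η, phiB a₃ β ω < fFun a₁ a₂ ξ η ω) := by
  obtain ⟨h₁, h₂⟩ := sin_ne_zero_of_notMem_dispSet hω h
  by_contra! hc
  obtain ⟨⟨ξ, η, hle⟩, ξ', η', hge⟩ := hc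
  obtain ⟨p, hp⟩ := mem_range_of_exists_le_of_exists_ge (continuous_fFun a₁ a₂ ω)
    ⟨(ξ', η'), hge⟩ ⟨(ξ, η), hle⟩
  refine h ⟨hω, arccos (Real.cos p.1), ⟨arccos_nonneg _, arccos_le_pi _⟩,
    arccos (Real.cos p.2), ⟨arccos_nonneg _, arccos_le_pi _⟩, ?_⟩
  have hcos : ∀ x, Real.cos (arccos (Real.cos x)) = Real.cos x := fun x =>
    Real.cos_arccos (Real.neg_one_le_cos _) (Real.cos_le_one _)
  rw [Dfun_eq_mul _ _ h₁ h₂ h₃, ← hp]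
  simp [fFun, hcos]

lemma phiB_div_pos {a₁ a₂ a₃ β ω : ℝ}
    (h : (∀ ξ η, fFun a₁ a₂ ξ η ω < phiB a₃ β ω) ∨ (∀ ξ η, phiB a₃ β ω < fFun a₁ a₂ ξ η ω))
    (ξ η : ℝ) : 0 < phiB a₃ β ω / (phiB a₃ β ω - fFun a₁ a₂ ξ η ω) := by
  rcases h with h | h
  · have h0 := h (ω * a₁) (ω * a₂)
    rw [fFun_self] at h0
    exact div_pos h0 (sub_pos.2 (h ξ η))
  · have h0 := h (ω * a₁) (ω * a₂)
    rw [fFun_self] at h0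
    exact div_pos_of_neg_of_neg h0 (sub_neg.2 (h ξ η))

lemma continuous_phiB_div {a₁ a₂ a₃ β ω : ℝ}
    (h : (∀ ξ η, fFun a₁ a₂ ξ η ω < phiB a₃ β ω) ∨
      (∀ ξ η, phiB a₃ β ω < fFun a₁ a₂ ξ η ω)) :
    Continuous fun p : ℝ × ℝ => phiB a₃ β ω / (phiB a₃ β ω - fFun a₁ a₂ p.1 p.2 ω) := by
  refine continuous_const.div (continuous_const.sub (continuous_fFun a₁ a₂ ω)) fun p => ?_
  rcases h with h | h
  · exact (sub_pos.2 (h _ _)).ne'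
  · exact (sub_neg.2 (h _ _)).ne

lemma eventually_sin_mul_ne_zero {a x : ℝ} (ha : 0 < a) :
    ∀ᶠ ω in 𝓝[≠] x, Real.sin (ω * a) ≠ 0 := by
  by_cases h : Real.sin (x * a) = 0
  · have hd : HasDerivAt (fun ω => Real.sin (ω * a)) (Real.cos (x * a) * a) x := by
      simpa using ((hasDerivAt_id x).mul_const a).sin
    refine hd.eventually_ne (mul_ne_zero (fun hc => ?_) ha.ne')
    nlinarith [Real.sin_sq_add_cos_sq (x * a)]
  · have hc : ContinuousAt (fun ω => Real.sin (ω * a)) x := by fun_prop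
    exact (hc.eventually_ne h).filter_mono nhdsWithin_le_nhds

lemma sin_mul_ne_zero_of_notMem {a x : ℝ} (ha : 0 < a) (hx : 0 < x)
    (h : ¬ ∃ n : ℕ, 1 ≤ n ∧ x = π * n / a) : Real.sin (x * a) ≠ 0 := by
  intro h0
  obtain ⟨n, hn⟩ := Real.sin_eq_zero_iff.1 h0
  have hxa : 0 < x * a := mul_pos hx ha
  have hn0 : 0 < n := by
    rw [← hn] at hxa
    exact_mod_cast (pos_iff_pos_of_mul_pos hxa).2 pi_pos
  lift n to ℕ using hn0.le
  refine h ⟨n, by exact_mod_cast hn0, ?_⟩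
  rw [eq_div_iff ha.ne', ← hn]
  push_cast
  ring

lemma sin_mul_eq_zero_of_eq {a x : ℝ} (ha : 0 < a) (h : ∃ n : ℕ, 1 ≤ n ∧ x = π * n / a) :
    Real.sin (x * a) = 0 := by
  obtain ⟨n, -, rfl⟩ := h
  rw [div_mul_cancel₀ _ ha.ne', mul_comm]
  exact Real.sin_nat_mul_pi n

lemma cos_sq_eq_one_of_fFun_extremal {a₁ a₂ ω k₁ k₂ : ℝ} (h₁ : Real.sin (ω * a₁) ≠ 0)
    (h₂ : Real.sin (ω * a₂) ≠ 0)
    (h : (∀ ξ η, fFun a₁ a₂ ξ η ω ≤ fFun a₁ a₂ k₁ k₂ ω) ∨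
      (∀ ξ η, fFun a₁ a₂ k₁ k₂ ω ≤ fFun a₁ a₂ ξ η ω)) :
    Real.cos k₁ ^ 2 = 1 ∧ Real.cos k₂ ^ 2 = 1 := by
  have key : ∀ s c d : ℝ, s ≠ 0 → c ^ 2 ≤ 1 →
      (((1 - d) / s ≤ (c - d) / s ∧ (-1 - d) / s ≤ (c - d) / s) ∨
        ((c - d) / s ≤ (1 - d) / s ∧ (c - d) / s ≤ (-1 - d) / s)) → c ^ 2 = 1 := by
    intro s c d hs hc hh
    refine le_antisymm hc ?_
    have hm : 0 ≤ ((1 - c) / s) * ((-1 - c) / s) := by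
      have e₁ : (1 - c) / s = (1 - d) / s - (c - d) / s := by ring
      have e₂ : (-1 - c) / s = (-1 - d) / s - (c - d) / s := by ring
      rw [e₁, e₂]
      rcases hh with ⟨p, q⟩ | ⟨p, q⟩
      · exact mul_nonneg_of_nonpos_of_nonpos (by linarith) (by linarith)
      · exact mul_nonneg (by linarith) (by linarith)
    have e : ((1 - c) / s) * ((-1 - c) / s) = (c ^ 2 - 1) / s ^ 2 := by
      field_simp
      ring
    rw [e, le_div_iff₀ (by positivity)] at hm
    linarith
  constructor
  · refine key _ _ (Real.cos (ω * a₁)) h₁ (Real.cos_sq_le_one _) ?_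
    refine h.imp (fun h => ?_) (fun h => ?_) <;>
    · have p := h 0 k₂
      have q := h π k₂
      simp only [fFun, Real.cos_zero, Real.cos_pi] at p q
      constructor <;> linarith
  · refine key _ _ (Real.cos (ω * a₂)) h₂ (Real.cos_sq_le_one _) ?_
    refine h.imp (fun h => ?_) (fun h => ?_) <;>
    · have p := h k₁ 0
      have q := h k₁ π
      simp only [fFun, Real.cos_zero, Real.cos_pi] at p q
      constructor <;> linarith

lemma fFun_extremal_of_tendsto {a₁ a₂ ω l : ℝ} {φ : ℝ → ℝ} {F : Filter ℝ} [F.NeBot]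
    (hF : F ≤ 𝓝 ω) (h₁ : Real.sin (ω * a₁) ≠ 0) (h₂ : Real.sin (ω * a₂) ≠ 0)
    (hφ : Tendsto φ F (𝓝 l))
    (h : ∀ᶠ x in F, (∀ ξ η, fFun a₁ a₂ ξ η x < φ x) ∨ (∀ ξ η, φ x < fFun a₁ a₂ ξ η x)) :
    (∀ ξ η, fFun a₁ a₂ ξ η ω ≤ l) ∨ (∀ ξ η, l ≤ fFun a₁ a₂ ξ η ω) := by
  have ht : ∀ ξ η, Tendsto (fun x => fFun a₁ a₂ ξ η x) F (𝓝 (fFun a₁ a₂ ξ η ω)) :=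
    fun ξ η => (continuousAt_fFun ξ η h₁ h₂).tendsto.mono_left hF
  rcases Filter.frequently_or_distrib.1 h.frequently with h | h
  · exact Or.inl fun ξ η => le_of_tendsto_of_tendsto_of_frequently (ht ξ η) hφ
      (h.mono fun x hx => (hx ξ η).le)
  · exact Or.inr fun ξ η => le_of_tendsto_of_tendsto_of_frequently hφ (ht ξ η)
      (h.mono fun x hx => (hx ξ η).le)

lemma abs_cos_sub_cos_le {k : ℝ} (hk : Real.cos k ^ 2 = 1) (x : ℝ) :
    |Real.cos k - Real.cos x| ≤ (x - k) ^ 2 := by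
  have hs : Real.sin k = 0 := by nlinarith [Real.sin_sq_add_cos_sq k]
  have hx : Real.cos x = Real.cos (x - k) * Real.cos k := by
    conv_lhs => rw [← sub_add_cancel x k, Real.cos_add, hs]
    ring
  have e : Real.cos k - Real.cos x = Real.cos k * (1 - Real.cos (x - k)) := by rw [hx]; ring
  have habs : |Real.cos k| = 1 := by
    rwa [← sq_eq_sq₀ (abs_nonneg _) zero_le_one, sq_abs, one_pow]
  rw [e, abs_mul, habs, one_mul,
    abs_of_nonneg (by linarith [Real.cos_le_one (x - k)])]
  nlinarith [Real.one_sub_sq_div_two_le_cos (x := x - k), sq_nonneg (x - k)]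

lemma integrableOn_square {g : ℝ × ℝ → ℝ} (hg : Continuous g) :
    IntegrableOn g (Ioo (0 : ℝ) (2 * π) ×ˢ Ioo (0 : ℝ) (2 * π)) :=
  (hg.continuousOn.integrableOn_compact (isCompact_Icc.prod isCompact_Icc)).mono_set
    (prod_mono Ioo_subset_Icc_self Ioo_subset_Icc_self)

lemma volume_real_square :
    volume.real (Ioo (0 : ℝ) (2 * π) ×ˢ Ioo (0 : ℝ) (2 * π)) = 4 * π ^ 2 := by
  rw [Measure.real, Measure.volume_eq_prod, Measure.prod_prod, Real.volume_Ioo,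
    ENNReal.toReal_mul, ENNReal.toReal_ofReal (by linarith [pi_pos])]
  ring

/-- A doubly-quadratic pole contributes a logarithm to the integral over the square. -/
lemma log_le_integral_square {g : ℝ × ℝ → ℝ} (hg : Continuous g) {k₁ k₂ c ε K : ℝ}
    (hk₁ : k₁ ∈ Icc 0 π) (hk₂ : k₂ ∈ Icc 0 π) (hc : 0 < c) (hε : 0 < ε) (hK : 0 < K)
    (h : ∀ x y, c / (ε + K * ((x - k₁) ^ 2 + (y - k₂) ^ 2)) ≤ g (x, y)) :
    c / (4 * K) * (Real.log (ε + 2 * K * π ^ 2) - Real.log ε) ≤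
      ∫ p in Ioo (0 : ℝ) (2 * π) ×ˢ Ioo (0 : ℝ) (2 * π), g p := by
  have hint := integrableOn_square hg
  have hg0 : ∀ p, 0 ≤ g p := fun p => le_trans (by positivity) (h p.1 p.2)
  have hinner : ∀ x ∈ Ioo k₁ (k₁ + π),
      c * (x - k₁) / (ε + 2 * K * (x - k₁) ^ 2) ≤ ∫ y in Ioo (0 : ℝ) (2 * π), g (x, y) := by
    intro x hx
    have hx0 : 0 < x - k₁ := sub_pos.2 hx.1
    have hgx : Continuous fun y => g (x, y) := hg.comp (by fun_prop)
    have hi : IntegrableOn (fun y => g (x, y)) (Ioo (0 : ℝ) (2 * π)) :=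
      (hgx.continuousOn.integrableOn_compact isCompact_Icc).mono_set Ioo_subset_Icc_self
    have hsub : Ioo k₂ (k₂ + (x - k₁)) ⊆ Ioo (0 : ℝ) (2 * π) := fun y hy =>
      ⟨by linarith [hk₂.1, hy.1], by linarith [hk₂.2, hy.2, hx.2]⟩
    calc c * (x - k₁) / (ε + 2 * K * (x - k₁) ^ 2)
        = ∫ _ in Ioo k₂ (k₂ + (x - k₁)), c / (ε + 2 * K * (x - k₁) ^ 2) := by
          rw [setIntegral_const, Real.volume_real_Ioo_of_le (by linarith), smul_eq_mul]
          ring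
      _ ≤ ∫ y in Ioo k₂ (k₂ + (x - k₁)), g (x, y) := by
          refine setIntegral_mono_on (integrableOn_const (by simp)) (hi.mono_set hsub)
            measurableSet_Ioo fun y hy => le_trans ?_ (h x y)
          have : (y - k₂) ^ 2 ≤ (x - k₁) ^ 2 :=
            pow_le_pow_left₀ (by linarith [hy.1]) (by linarith [hy.2]) 2
          refine div_le_div_of_nonneg_left hc.le (by positivity) ?_
          nlinarith
      _ ≤ _ := setIntegral_mono_set hi (Eventually.of_forall fun y => hg0 _)
          (LE.le.eventuallyLE hsub)
  have hder : ∀ x, HasDerivAt (fun x => c / (4 * K) * Real.log (ε + 2 * K * (x - k₁) ^ 2))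
      (c * (x - k₁) / (ε + 2 * K * (x - k₁) ^ 2)) x := by
    intro x
    have hpos : ε + 2 * K * (x - k₁) ^ 2 ≠ 0 := by positivity
    have := ((((((hasDerivAt_id x).sub_const k₁).pow 2).const_mul (2 * K)).const_add ε).log
      hpos).const_mul (c / (4 * K))
    refine this.congr_deriv ?_
    simp only [id, Pi.pow_apply]
    field_simp
    norm_num
  have hcont : Continuous fun x : ℝ => c * (x - k₁) / (ε + 2 * K * (x - k₁) ^ 2) := by
    refine Continuous.div (by fun_prop) (by fun_prop) fun x => by positivity
  have hftc := intervalIntegral.integral_eq_sub_of_hasDerivAt (a := k₁) (b := k₁ + π)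
    (fun x _ => hder x) (hcont.intervalIntegrable _ _)
  have hsub : Ioo k₁ (k₁ + π) ⊆ Ioo (0 : ℝ) (2 * π) := fun y hy =>
    ⟨by linarith [hk₁.1, hy.1], by linarith [hk₁.2, hy.2]⟩
  rw [intervalIntegral.integral_of_le (by linarith [pi_pos]), integral_Ioc_eq_integral_Ioo]
    at hftc
  rw [Measure.volume_eq_prod] at hint ⊢
  have houter : IntegrableOn (fun x => ∫ y in Ioo (0 : ℝ) (2 * π), g (x, y))
      (Ioo (0 : ℝ) (2 * π)) := by
    rw [IntegrableOn, ← Measure.prod_restrict] at hint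
    exact hint.integral_prod_left
  rw [setIntegral_prod _ hint]
  calc c / (4 * K) * (Real.log (ε + 2 * K * π ^ 2) - Real.log ε)
      = ∫ x in Ioo k₁ (k₁ + π), c * (x - k₁) / (ε + 2 * K * (x - k₁) ^ 2) := by
        rw [hftc]
        simp only [add_sub_cancel_left, sub_self]
        norm_num
        ring
    _ ≤ ∫ x in Ioo k₁ (k₁ + π), ∫ y in Ioo (0 : ℝ) (2 * π), g (x, y) :=
        setIntegral_mono_on
          ((hcont.continuousOn.integrableOn_compact isCompact_Icc).mono_set Ioo_subset_Icc_self)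
          (houter.mono_set hsub) measurableSet_Ioo hinner
    _ ≤ _ := setIntegral_mono_set houter
        (Eventually.of_forall fun x => integral_nonneg fun y => hg0 _)
        (LE.le.eventuallyLE hsub)

lemma tendsto_phiB_zero {a₃ β x : ℝ} (hs : Real.sin (x * a₃) = 0)
    (hc : Real.cos (x * a₃) = Real.cos β) : Tendsto (phiB a₃ β) (𝓝 x) (𝓝 0) := by
  have hsq : Real.cos β ^ 2 = 1 := by
    rw [← hc]
    nlinarith [Real.sin_sq_add_cos_sq (x * a₃)]
  have hne : Real.cos (x * a₃) + Real.cos β ≠ 0 := by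
    intro h
    rw [hc] at h
    nlinarith
  have hcont : ContinuousAt (fun ω => Real.cos (ω * a₃) + Real.cos β) x := by fun_prop
  have hlim : ContinuousAt
      (fun ω => -Real.sin (ω * a₃) / (Real.cos (ω * a₃) + Real.cos β)) x := by
    fun_prop (disch := assumption)
  have hlim' := hlim.tendsto
  simp only [hs, neg_zero, zero_div] at hlim'
  refine hlim'.congr' ?_
  filter_upwards [hcont.eventually_ne hne] with ω hω
  unfold phiB
  by_cases h0 : Real.sin (ω * a₃) = 0
  · simp [h0]
  · rw [div_eq_div_iff hω h0]
    nlinarith [Real.sin_sq_add_cos_sq (ω * a₃)]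

lemma tendsto_FB_zero {a₁ a₂ a₃ β ωt : ℝ} {l : Filter ℝ} [l.NeBot] (hl : l ≤ 𝓝[≠] ωt)
    (ha₃ : 0 < a₃) (h₁ : Real.sin (ωt * a₁) ≠ 0) (h₂ : Real.sin (ωt * a₂) ≠ 0)
    (hmem : ωt ∈ dispSet a₁ a₂ a₃ β)
    (hgap : ∀ᶠ ω in l, 0 < ω ∧ ω ∉ dispSet a₁ a₂ a₃ β) :
    Tendsto (fun ω => FB a₁ a₂ a₃ β ω) l (𝓝 0) := by
  have hl' : l ≤ 𝓝 ωt := hl.trans nhdsWithin_le_nhds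
  have hdich : ∀ᶠ ω in l, (∀ ξ η, fFun a₁ a₂ ξ η ω < phiB a₃ β ω) ∨
      (∀ ξ η, phiB a₃ β ω < fFun a₁ a₂ ξ η ω) := by
    filter_upwards [hgap, (eventually_sin_mul_ne_zero ha₃).filter_mono hl] with ω hω h₃
    exact fFun_lt_or_lt_of_notMem_dispSet hω.1 hω.2 h₃
  have hnz : ¬ Tendsto (phiB a₃ β) l (𝓝 0) := by
    intro h0
    have h := fFun_extremal_of_tendsto hl' h₁ h₂ h0 hdich
    rw [← fFun_self a₁ a₂ ωt] at h
    have hc := (cos_sq_eq_one_of_fFun_extremal h₁ h₂ h).1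
    apply h₁
    nlinarith [Real.sin_sq_add_cos_sq (ωt * a₁)]
  obtain ⟨-, k₁, hk₁, k₂, hk₂, hD⟩ := hmem
  have h₃ : Real.sin (ωt * a₃) ≠ 0 := by
    intro h₃
    refine hnz ((tendsto_phiB_zero h₃ ?_).mono_left hl')
    simpa [Dfun, h₃, h₁, h₂, sub_eq_zero] using hD
  have hφ : Tendsto (phiB a₃ β) l (𝓝 (phiB a₃ β ωt)) := by
    have : ContinuousAt (phiB a₃ β) ωt := by
      unfold phiB
      fun_prop (disch := assumption)
    exact this.tendsto.mono_left hl'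
  have hφ0 : phiB a₃ β ωt ≠ 0 := fun h0 => hnz (h0 ▸ hφ)
  have hφk : phiB a₃ β ωt = fFun a₁ a₂ k₁ k₂ ωt := by
    rw [Dfun_eq_mul _ _ h₁ h₂ h₃] at hD
    simpa [h₁, h₂, h₃, sub_eq_zero] using hD
  obtain ⟨hc₁, hc₂⟩ := cos_sq_eq_one_of_fFun_extremal h₁ h₂
    (hφk ▸ fFun_extremal_of_tendsto hl' h₁ h₂ hφ hdich)
  set K : ℝ := 1 / |Real.sin (ωt * a₁)| + 1 / |Real.sin (ωt * a₂)| + 1 with hKdef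
  have hK : 0 < K := by positivity
  have hKev : ∀ᶠ ω in l, 1 / |Real.sin (ω * a₁)| + 1 / |Real.sin (ω * a₂)| < K := by
    have h₁' := abs_ne_zero.2 h₁
    have h₂' := abs_ne_zero.2 h₂
    have hc : ContinuousAt
        (fun ω => 1 / |Real.sin (ω * a₁)| + 1 / |Real.sin (ω * a₂)|) ωt := by
      fun_prop (disch := assumption)
    exact (hc.tendsto.mono_left hl').eventually_lt_const (by rw [hKdef]; linarith)
  have hφev : ∀ᶠ ω in l, |phiB a₃ β ωt| / 2 < |phiB a₃ β ω| :=
    hφ.abs.eventually_const_lt (half_lt_self (abs_pos.2 hφ0))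
  have hε : Tendsto (fun ω => |phiB a₃ β ω - fFun a₁ a₂ k₁ k₂ ω|) l (𝓝[>] 0) := by
    refine tendsto_nhdsWithin_iff.2 ⟨?_, ?_⟩
    · have := (hφ.sub ((continuousAt_fFun k₁ k₂ h₁ h₂).tendsto.mono_left hl')).abs
      simpa [hφk] using this
    · filter_upwards [hdich] with ω hω
      rw [Set.mem_Ioi, abs_pos]
      rcases hω with hω | hω
      · exact (sub_pos.2 (hω _ _)).ne'
      · exact (sub_neg.2 (hω _ _)).ne
  have hlow : ∀ᶠ ω in l, 1 / (4 * π ^ 2) * (|phiB a₃ β ωt| / 2 / (4 * K) *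
      (Real.log (2 * K * π ^ 2) - Real.log |phiB a₃ β ω - fFun a₁ a₂ k₁ k₂ ω|)) ≤
      IB a₁ a₂ a₃ β ω := by
    filter_upwards [hdich, hKev, hφev, (tendsto_nhdsWithin_iff.1 hε).2] with ω hω hKω hφω hεω
    have hεω : 0 < |phiB a₃ β ω - fFun a₁ a₂ k₁ k₂ ω| := hεω
    have hlog := log_le_integral_square (continuous_phiB_div hω) hk₁ hk₂
      (half_pos (abs_pos.2 hφ0)) hεω hK (fun x y => by
        rw [← abs_of_pos (phiB_div_pos hω x y), abs_div]
        have hden : 0 < |phiB a₃ β ω - fFun a₁ a₂ x y ω| := by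
          refine abs_pos.2 fun h0 => ?_
          simpa [h0] using phiB_div_pos hω x y
        refine div_le_div₀ (abs_nonneg _) hφω.le hden ?_
        have hsplit : phiB a₃ β ω - fFun a₁ a₂ x y ω = phiB a₃ β ω - fFun a₁ a₂ k₁ k₂ ω +
            ((Real.cos k₁ - Real.cos x) / Real.sin (ω * a₁) +
              (Real.cos k₂ - Real.cos y) / Real.sin (ω * a₂)) := by
          unfold fFun
          ring
        rw [hsplit]
        refine (abs_add_le _ _).trans (add_le_add le_rfl ((abs_add_le _ _).trans ?_))
        rw [abs_div, abs_div, mul_add]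
        have hp₁ : 0 ≤ 1 / |Real.sin (ω * a₁)| := by positivity
        have hp₂ : 0 ≤ 1 / |Real.sin (ω * a₂)| := by positivity
        rw [div_eq_mul_one_div, mul_comm, div_eq_mul_one_div (|Real.cos k₂ - _|),
          mul_comm (|Real.cos k₂ - _|)]
        exact add_le_add
          (mul_le_mul (by linarith) (abs_cos_sub_cos_le hc₁ x) (abs_nonneg _) hK.le)
          (mul_le_mul (by linarith) (abs_cos_sub_cos_le hc₂ y) (abs_nonneg _) hK.le))
    unfold IB
    refine mul_le_mul_of_nonneg_left (le_trans ?_ hlog) (by positivity)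
    refine mul_le_mul_of_nonneg_left (sub_le_sub_right (Real.log_le_log ?_ ?_) _) (by positivity)
    · have := pi_pos
      positivity
    · linarith
  have hI : Tendsto (fun ω => IB a₁ a₂ a₃ β ω) l atTop := by
    refine tendsto_atTop_mono' l hlow ?_
    have hc : 0 < |phiB a₃ β ωt| / 2 / (4 * K) := by
      have := abs_pos.2 hφ0
      positivity
    refine Tendsto.const_mul_atTop (by have := pi_pos; positivity)
      (Tendsto.const_mul_atTop hc ?_)
    simp only [sub_eq_add_neg]
    exact tendsto_atTop_add_const_left _ _
      (tendsto_neg_atBot_atTop.comp (Real.tendsto_log_nhdsGT_zero.comp hε))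
  exact tendsto_inv_atTop_zero.comp hI

/-- Local half-angle parametrisation of `ω * a` to the right of `x`, modulo `π`. -/
lemma exists_half_angle {a : ℝ} (ha : 0 < a) (x : ℝ) :
    ∃ (σ : ℝ) (t : ℝ → ℝ) (r : ℝ), x < r ∧ (σ = 1 ∨ σ = -1) ∧ ContinuousAt t x ∧
      0 ≤ t x ∧ StrictMonoOn t (Ioo x r) ∧
      (∀ ω ∈ Ioo x r, 0 < t ω ∧ Real.sin (ω * a) = σ * (2 * t ω / (1 + t ω ^ 2)) ∧
        Real.cos (ω * a) = σ * ((1 - t ω ^ 2) / (1 + t ω ^ 2))) ∧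
      (Real.sin (x * a) = 0 → t x = 0) := by
  set n : ℤ := ⌊x * a / π⌋
  have hn₁ : n * π ≤ x * a := (le_div_iff₀ pi_pos).1 (Int.floor_le _)
  have hn₂ : x * a < (n + 1) * π := (div_lt_iff₀ pi_pos).1 (Int.lt_floor_add_one _)
  have hmem : ∀ ω ∈ Ico x ((n + 1) * π / a), 0 ≤ (ω * a - n * π) / 2 ∧
      (ω * a - n * π) / 2 < π / 2 := by
    intro ω hω
    have h₁ := mul_le_mul_of_nonneg_right hω.1 ha.le
    have h₂ := (lt_div_iff₀ ha).1 hω.2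
    constructor <;> linarith
  have hx : x ∈ Ico x ((n + 1) * π / a) := ⟨le_rfl, (lt_div_iff₀ ha).2 hn₂⟩
  have hcos : ∀ ω ∈ Ico x ((n + 1) * π / a), 0 < Real.cos ((ω * a - n * π) / 2) := fun ω hω =>
    Real.cos_pos_of_mem_Ioo ⟨by linarith [(hmem ω hω).1, pi_pos], (hmem ω hω).2⟩
  have hsign : ((-1 : ℝ) ^ n) = 1 ∨ ((-1 : ℝ) ^ n) = -1 := by
    rcases Int.even_or_odd n with h | h
    · exact Or.inl h.neg_one_zpow
    · exact Or.inr h.neg_one_zpow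
  refine ⟨(-1) ^ n, fun ω => Real.tan ((ω * a - n * π) / 2), (n + 1) * π / a, hx.2, hsign,
    ?_, ?_, ?_, ?_, ?_⟩
  · have h := (Real.continuousAt_tan (x := (x * a - n * π) / 2)).2 (hcos x hx).ne'
    exact ContinuousAt.comp (f := fun ω : ℝ => (ω * a - n * π) / 2) h (by fun_prop)
  · exact Real.tan_nonneg_of_nonneg_of_le_pi_div_two (hmem x hx).1 (hmem x hx).2.le
  · intro y hy z hz hyz
    refine Real.tan_lt_tan_of_nonneg_of_lt_pi_div_two (hmem y (Ioo_subset_Ico_self hy)).1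
      (hmem z (Ioo_subset_Ico_self hz)).2 ?_
    have := mul_lt_mul_of_pos_right hyz ha
    linarith
  · intro ω hω
    have hω' := Ioo_subset_Ico_self hω
    have hc := hcos ω hω'
    have hpos : 0 < (ω * a - n * π) / 2 := by
      have := mul_lt_mul_of_pos_right hω.1 ha
      linarith
    have hs : (-1 : ℝ) ^ n * (-1 : ℝ) ^ n = 1 := by rcases hsign with h | h <;> rw [h] <;> norm_num
    have hsc := Real.sin_sq_add_cos_sq ((ω * a - n * π) / 2)
    have hθ : ω * a - n * π = 2 * ((ω * a - n * π) / 2) := by ring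
    refine ⟨Real.tan_pos_of_pos_of_lt_pi_div_two hpos (hmem ω hω').2, ?_, ?_⟩
    · have h := Real.sin_sub_int_mul_pi (ω * a) n
      rw [hθ, Real.sin_two_mul] at h
      have e : Real.sin (ω * a) = (-1) ^ n * (2 * Real.sin ((ω * a - n * π) / 2) *
          Real.cos ((ω * a - n * π) / 2)) := by
        rw [h, ← mul_assoc, hs, one_mul]
      simp only [e, Real.tan_eq_sin_div_cos]
      field_simp
      linear_combination Real.sin ((ω * a - n * π) / 2) * hsc
    · have h := Real.cos_sub_int_mul_pi (ω * a) n
      rw [hθ, Real.cos_two_mul'] at h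
      have e : Real.cos (ω * a) = (-1) ^ n * (Real.cos ((ω * a - n * π) / 2) ^ 2 -
          Real.sin ((ω * a - n * π) / 2) ^ 2) := by
        rw [h, ← mul_assoc, hs, one_mul]
      simp only [e, Real.tan_eq_sin_div_cos]
      field_simp
      linear_combination (Real.cos ((ω * a - n * π) / 2) ^ 2 - Real.sin ((ω * a - n * π) / 2) ^ 2) * hsc
  · intro h
    obtain ⟨m, hm⟩ := Real.sin_eq_zero_iff.1 h
    have : n = m := by
      simp only [n, ← hm, mul_div_cancel_right₀ _ pi_ne_zero, Int.floor_intCast]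
    simp [← hm, this]

/-- The value of `(u - cos) / sin` in the half-angle parametrisation, with `v = ± u`. -/
def halfAngleQuot (v t : ℝ) : ℝ := (1 + v) / 2 * t - (1 - v) / 2 * t⁻¹

lemma div_eq_halfAngleQuot {σ t S C : ℝ} (u : ℝ) (hσ : σ = 1 ∨ σ = -1) (ht : 0 < t)
    (hS : S = σ * (2 * t / (1 + t ^ 2))) (hC : C = σ * ((1 - t ^ 2) / (1 + t ^ 2))) :
    (u - C) / S = halfAngleQuot (σ * u) t := by
  subst hS hC
  have : 1 + t ^ 2 ≠ 0 := by positivity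
  unfold halfAngleQuot
  rcases hσ with rfl | rfl <;> (field_simp; ring)

lemma halfAngleQuot_mono {v t t' : ℝ} (hv : |v| ≤ 1) (ht : 0 < t) (htt : t ≤ t') :
    halfAngleQuot v t ≤ halfAngleQuot v t' := by
  obtain ⟨h₁, h₂⟩ := abs_le.1 hv
  have hinv : t'⁻¹ ≤ t⁻¹ := inv_anti₀ ht htt
  unfold halfAngleQuot
  gcongr
  linarith

lemma halfAngleQuot_le {v t : ℝ} (hv : |v| ≤ 1) (ht : 0 < t) :
    halfAngleQuot v t ≤ t - (1 - v) / 2 * t⁻¹ := by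
  obtain ⟨h₁, h₂⟩ := abs_le.1 hv
  unfold halfAngleQuot
  nlinarith

lemma abs_mul_cos_le_one {σ : ℝ} (hσ : σ = 1 ∨ σ = -1) (x : ℝ) : |σ * Real.cos x| ≤ 1 := by
  rcases hσ with rfl | rfl <;> simpa using Real.abs_cos_le_one x

lemma ae_mul_cos_lt_one {σ : ℝ} (hσ : σ = 1 ∨ σ = -1) : ∀ᵐ x : ℝ, σ * Real.cos x < 1 := by
  have hcount : {x : ℝ | Real.sin x = 0}.Countable := by
    refine (countable_range fun n : ℤ => (n : ℝ) * π).mono fun x hx => ?_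
    obtain ⟨n, hn⟩ := Real.sin_eq_zero_iff.1 hx
    exact ⟨n, hn⟩
  filter_upwards [compl_mem_ae_iff.2 (hcount.measure_zero volume)] with x hx
  refine lt_of_le_of_ne (abs_le.1 (abs_mul_cos_le_one hσ x)).2 fun h => hx ?_
  have hsq : Real.cos x ^ 2 = 1 := by
    have : (σ * Real.cos x) ^ 2 = 1 := by rw [h, one_pow]
    rcases hσ with rfl | rfl <;> nlinarith
  show Real.sin x = 0
  nlinarith [Real.sin_sq_add_cos_sq x]

lemma tendsto_integral_inv_zero {l : Filter ℝ} [l.IsCountablyGenerated] {σ₁ σ₂ δ : ℝ}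
    {t₁ t₂ : ℝ → ℝ} (hσ₁ : σ₁ = 1 ∨ σ₁ = -1) (hσ₂ : σ₂ = 1 ∨ σ₂ = -1) (hδ : 0 < δ)
    (hpos : ∀ᶠ ω in l, 0 < t₁ ω ∧ 0 < t₂ ω)
    (hmin : Tendsto (fun ω => min (t₁ ω) (t₂ ω)) l (𝓝 0)) :
    Tendsto (fun ω => ∫ p in Ioo (0 : ℝ) (2 * π) ×ˢ Ioo (0 : ℝ) (2 * π),
      (δ + (1 - σ₁ * Real.cos p.1) / 2 * (t₁ ω)⁻¹ + (1 - σ₂ * Real.cos p.2) / 2 * (t₂ ω)⁻¹)⁻¹)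
      l (𝓝 0) := by
  have hnn : ∀ {σ : ℝ}, (σ = 1 ∨ σ = -1) → ∀ x, 0 ≤ 1 - σ * Real.cos x := fun hσ x => by
    linarith [(abs_le.1 (abs_mul_cos_le_one hσ x)).2]
  have key := tendsto_integral_filter_of_dominated_convergence
    (μ := volume.restrict (Ioo (0 : ℝ) (2 * π) ×ˢ Ioo (0 : ℝ) (2 * π))) (l := l)
    (F := fun ω p => (δ + (1 - σ₁ * Real.cos p.1) / 2 * (t₁ ω)⁻¹ +
      (1 - σ₂ * Real.cos p.2) / 2 * (t₂ ω)⁻¹)⁻¹) (f := fun _ => 0) (fun _ => δ⁻¹)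
    ?_ ?_ (integrableOn_square continuous_const) ?_
  · simpa using key
  · exact Eventually.of_forall fun ω => (by fun_prop : Measurable _).aestronglyMeasurable
  · filter_upwards [hpos] with ω hω
    refine Eventually.of_forall fun p => ?_
    have := hnn hσ₁ p.1
    have := hnn hσ₂ p.2
    have := hω.1
    have := hω.2
    have hge : δ ≤ δ + (1 - σ₁ * Real.cos p.1) / 2 * (t₁ ω)⁻¹ +
        (1 - σ₂ * Real.cos p.2) / 2 * (t₂ ω)⁻¹ := by
      rw [add_assoc]
      exact le_add_of_nonneg_right (by positivity)
    rw [Real.norm_of_nonneg (by positivity)]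
    exact inv_anti₀ hδ hge
  · refine ae_restrict_of_ae ?_
    filter_upwards [Measure.quasiMeasurePreserving_fst.ae (ae_mul_cos_lt_one hσ₁),
      Measure.quasiMeasurePreserving_snd.ae (ae_mul_cos_lt_one hσ₂)] with p hp₁ hp₂
    set c := min ((1 - σ₁ * Real.cos p.1) / 2) ((1 - σ₂ * Real.cos p.2) / 2)
    have hc0 : 0 < c := lt_min (by linarith) (by linarith)
    have hlim : Tendsto (fun ω => c⁻¹ * min (t₁ ω) (t₂ ω)) l (𝓝 0) := by
      simpa using hmin.const_mul c⁻¹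
    refine squeeze_zero' ?_ ?_ hlim
    · filter_upwards [hpos] with ω hω
      have := hnn hσ₁ p.1
      have := hnn hσ₂ p.2
      have := hω.1
      have := hω.2
      positivity
    · filter_upwards [hpos] with ω hω
      have hm : 0 < min (t₁ ω) (t₂ ω) := lt_min hω.1 hω.2
      have h₁ : 0 ≤ (1 - σ₁ * Real.cos p.1) / 2 * (t₁ ω)⁻¹ :=
        mul_nonneg (by linarith) (inv_nonneg.2 hω.1.le)
      have h₂ : 0 ≤ (1 - σ₂ * Real.cos p.2) / 2 * (t₂ ω)⁻¹ :=
        mul_nonneg (by linarith) (inv_nonneg.2 hω.2.le)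
      have hge : c * (min (t₁ ω) (t₂ ω))⁻¹ ≤ δ + (1 - σ₁ * Real.cos p.1) / 2 * (t₁ ω)⁻¹ +
          (1 - σ₂ * Real.cos p.2) / 2 * (t₂ ω)⁻¹ := by
        rcases min_choice (t₁ ω) (t₂ ω) with h | h <;> rw [h]
        · have := mul_le_mul_of_nonneg_right (min_le_left _ _ : c ≤ _) (inv_nonneg.2 hω.1.le)
          linarith
        · have := mul_le_mul_of_nonneg_right (min_le_right _ _ : c ≤ _) (inv_nonneg.2 hω.2.le)
          linarith
      calc _ ≤ (c * (min (t₁ ω) (t₂ ω))⁻¹)⁻¹ := inv_anti₀ (by positivity) hge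
        _ = _ := by rw [mul_inv, inv_inv]

lemma IB_pos {a₁ a₂ a₃ β ω : ℝ}
    (h : (∀ ξ η, fFun a₁ a₂ ξ η ω < phiB a₃ β ω) ∨
      (∀ ξ η, phiB a₃ β ω < fFun a₁ a₂ ξ η ω)) : 0 < IB a₁ a₂ a₃ β ω := by
  have hpos : ∀ p : ℝ × ℝ, 0 < phiB a₃ β ω / (phiB a₃ β ω - fFun a₁ a₂ p.1 p.2 ω) :=
    fun p => phiB_div_pos h p.1 p.2
  have hπ := pi_pos
  refine mul_pos (by positivity) ((setIntegral_pos_iff_support_of_nonneg_ae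
    (Eventually.of_forall fun p => (hpos p).le)
    (integrableOn_square (continuous_phiB_div h))).2 ?_)
  have hsupp : Function.support (fun p : ℝ × ℝ =>
      phiB a₃ β ω / (phiB a₃ β ω - fFun a₁ a₂ p.1 p.2 ω)) = univ :=
    eq_univ_of_forall fun p => (hpos p).ne'
  rw [hsupp, univ_inter, Measure.volume_eq_prod, Measure.prod_prod]
  simp [hπ]

lemma limsup_nonpos_of_eventually_le {l : Filter ℝ} {u v : ℝ → ℝ} (h : ∀ᶠ x in l, u x ≤ v x)
    (hv : Tendsto v l (𝓝 0)) : limsup u l ≤ 0 := by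
  rw [limsup_eq]
  by_cases hb : BddBelow {a | ∀ᶠ x in l, u x ≤ a}
  · refine le_of_forall_pos_le_add fun ε hε => csInf_le hb ?_
    filter_upwards [h, hv.eventually_lt_const hε] with x hx hx'
    linarith
  · exact (Real.sInf_of_not_bddBelow hb).le

lemma limsup_one_sub_FB_nonpos {a₁ a₂ a₃ β ωb ωt : ℝ} (ha₁ : 0 < a₁) (ha₂ : 0 < a₂)
    (ha₃ : 0 < a₃) (hωb : 0 < ωb) (hlt : ωb < ωt)
    (hb : Real.sin (ωb * a₁) = 0 ∨ Real.sin (ωb * a₂) = 0)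
    (hgap : ∀ ω ∈ Ioo ωb ωt, ω ∉ dispSet a₁ a₂ a₃ β) :
    limsup (fun ω => 1 - FB a₁ a₂ a₃ β ω) (𝓝[>] ωb) ≤ 0 := by
  obtain ⟨σ₁, t₁, r₁, hr₁, hσ₁, hc₁, ht₁, hm₁, hp₁, hz₁⟩ := exists_half_angle ha₁ ωb
  obtain ⟨σ₂, t₂, r₂, hr₂, hσ₂, hc₂, ht₂, hm₂, hp₂, hz₂⟩ := exists_half_angle ha₂ ωb
  obtain ⟨σ₃, t₃, r₃, hr₃, hσ₃, hc₃, ht₃, hm₃, hp₃, -⟩ := exists_half_angle ha₃ ωb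
  have hf : ∀ ω ∈ Ioo ωb r₁, ω ∈ Ioo ωb r₂ → ∀ ξ η, fFun a₁ a₂ ξ η ω =
      halfAngleQuot (σ₁ * Real.cos ξ) (t₁ ω) + halfAngleQuot (σ₂ * Real.cos η) (t₂ ω) := by
    intro ω h₁ h₂ ξ η
    obtain ⟨p₁, s₁, c₁⟩ := hp₁ ω h₁
    obtain ⟨p₂, s₂, c₂⟩ := hp₂ ω h₂
    rw [fFun, div_eq_halfAngleQuot _ hσ₁ p₁ s₁ c₁, div_eq_halfAngleQuot _ hσ₂ p₂ s₂ c₂]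
  have hφ : ∀ ω ∈ Ioo ωb r₃, phiB a₃ β ω = -halfAngleQuot (σ₃ * Real.cos β) (t₃ ω) := by
    intro ω h₃
    obtain ⟨p₃, s₃, c₃⟩ := hp₃ ω h₃
    rw [← div_eq_halfAngleQuot _ hσ₃ p₃ s₃ c₃, phiB]
    ring
  have hβ := abs_mul_cos_le_one hσ₃ β
  have hcos : ∀ {σ : ℝ}, (σ = 1 ∨ σ = -1) → ∃ ξ, σ * Real.cos ξ = 1 := by
    rintro σ (rfl | rfl)
    · exact ⟨0, by simp⟩
    · exact ⟨π, by simp⟩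
  have hcos' : ∀ {σ : ℝ}, (σ = 1 ∨ σ = -1) → ∃ ξ, σ * Real.cos ξ = -1 := by
    rintro σ (rfl | rfl)
    · exact ⟨π, by simp⟩
    · exact ⟨0, by simp⟩
  have hmin : Tendsto (fun ω => min (t₁ ω) (t₂ ω)) (𝓝[>] ωb) (𝓝 0) := by
    have h := (hc₁.tendsto.min hc₂.tendsto).mono_left (nhdsWithin_le_nhds (s := Ioi ωb))
    have h0 : min (t₁ ωb) (t₂ ωb) = 0 := by
      rcases hb with hb | hb
      · rw [hz₁ hb, min_eq_left ht₂]
      · rw [hz₂ hb, min_eq_right ht₁]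
    rwa [h0] at h
  have hev : ∀ᶠ ω in 𝓝[>] ωb, ω ∈ Ioo ωb r₁ ∧ ω ∈ Ioo ωb r₂ ∧ ω ∈ Ioo ωb r₃ ∧
      ∀ ξ η, fFun a₁ a₂ ξ η ω < phiB a₃ β ω := by
    have hprod : ∀ᶠ ω in 𝓝[>] ωb, min (t₁ ω) (t₂ ω) * t₃ ω < 1 := by
      refine (hmin.mul (hc₃.tendsto.mono_left nhdsWithin_le_nhds)).eventually_lt_const ?_
      simp
    filter_upwards [Ioo_mem_nhdsGT hr₁, Ioo_mem_nhdsGT hr₂, Ioo_mem_nhdsGT hr₃,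
      Ioo_mem_nhdsGT hlt, hprod] with ω h₁ h₂ h₃ hω hlt1
    refine ⟨h₁, h₂, h₃, ?_⟩
    have p₁ := (hp₁ ω h₁).1
    have p₂ := (hp₂ ω h₂).1
    obtain ⟨p₃, s₃, -⟩ := hp₃ ω h₃
    have hs₃ : Real.sin (ω * a₃) ≠ 0 := by
      have hq : 2 * t₃ ω / (1 + t₃ ω ^ 2) ≠ 0 := by positivity
      rw [s₃]
      exact mul_ne_zero (by rcases hσ₃ with h | h <;> rw [h] <;> norm_num) hq
    refine (fFun_lt_or_lt_of_notMem_dispSet (hωb.trans h₁.1) (hgap ω hω) hs₃).resolve_right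
      fun hcon => ?_
    obtain ⟨ξ, hξ⟩ := hcos' hσ₁
    obtain ⟨η, hη⟩ := hcos' hσ₂
    have hlt2 := hcon ξ η
    rw [hf ω h₁ h₂, hφ ω h₃, hξ, hη] at hlt2
    have hle := halfAngleQuot_le hβ p₃
    have hnn : 0 ≤ (1 - σ₃ * Real.cos β) / 2 * (t₃ ω)⁻¹ :=
      mul_nonneg (by linarith [(abs_le.1 hβ).2]) (inv_nonneg.2 p₃.le)
    simp only [halfAngleQuot] at hlt2 hle
    norm_num at hlt2
    have hi₁ := inv_pos.2 p₁
    have hi₂ := inv_pos.2 p₂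
    rcases min_choice (t₁ ω) (t₂ ω) with h | h <;> rw [h] at hlt1
    · have := mul_inv_cancel₀ p₁.ne'
      nlinarith
    · have := mul_inv_cancel₀ p₂.ne'
      nlinarith
  obtain ⟨u, hu, hgood⟩ := mem_nhdsGT_iff_exists_Ioo_subset.1 hev
  obtain ⟨ω₁, hω₁⟩ := exists_between (show ωb < u from hu)
  obtain ⟨g₁, g₂, g₃, hg⟩ := hgood hω₁
  set δ := phiB a₃ β ω₁ - (t₁ ω₁ + t₂ ω₁) with hδdef
  have hδ : 0 < δ := by
    obtain ⟨ξ, hξ⟩ := hcos hσ₁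
    obtain ⟨η, hη⟩ := hcos hσ₂
    have h := hg ξ η
    rw [hf ω₁ g₁ g₂, hξ, hη] at h
    norm_num [halfAngleQuot] at h
    exact sub_pos.2 h
  have hlim := tendsto_integral_inv_zero (l := 𝓝[>] ωb) hσ₁ hσ₂ hδ
    (hev.mono fun ω hω => ⟨(hp₁ ω hω.1).1, (hp₂ ω hω.2.1).1⟩) hmin
  set e : ℝ → ℝ := fun ω => ∫ p in Ioo (0 : ℝ) (2 * π) ×ˢ Ioo (0 : ℝ) (2 * π),
      (δ + (1 - σ₁ * Real.cos p.1) / 2 * (t₁ ω)⁻¹ + (1 - σ₂ * Real.cos p.2) / 2 * (t₂ ω)⁻¹)⁻¹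
  refine limsup_nonpos_of_eventually_le
    (v := fun ω => 1 / (4 * π ^ 2) * ((t₁ ω₁ + t₂ ω₁) * e ω)) ?_
    (by simpa only [mul_zero] using
      (hlim.const_mul (t₁ ω₁ + t₂ ω₁)).const_mul (1 / (4 * π ^ 2)))
  filter_upwards [Ioo_mem_nhdsGT hω₁.1] with ω hω
  obtain ⟨h₁, h₂, h₃, hfφ⟩ := hgood ⟨hω.1, hω.2.trans hω₁.2⟩
  have p₁ := (hp₁ ω h₁).1
  have p₂ := (hp₂ ω h₂).1
  have p₃ := (hp₃ ω h₃).1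
  have hφmono : phiB a₃ β ω₁ ≤ phiB a₃ β ω := by
    rw [hφ ω h₃, hφ ω₁ g₃]
    exact neg_le_neg (halfAngleQuot_mono hβ p₃ (hm₃ h₃ g₃ hω.2).le)
  have hm₁' := hm₁ h₁ g₁ hω.2
  have hm₂' := hm₂ h₂ g₂ hω.2
  have hnn₁ : ∀ x, 0 ≤ (1 - σ₁ * Real.cos x) / 2 * (t₁ ω)⁻¹ := fun x =>
    mul_nonneg (by linarith [(abs_le.1 (abs_mul_cos_le_one hσ₁ x)).2]) (inv_nonneg.2 p₁.le)
  have hnn₂ : ∀ x, 0 ≤ (1 - σ₂ * Real.cos x) / 2 * (t₂ ω)⁻¹ := fun x =>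
    mul_nonneg (by linarith [(abs_le.1 (abs_mul_cos_le_one hσ₂ x)).2]) (inv_nonneg.2 p₂.le)
  have hdpos : ∀ p : ℝ × ℝ, 0 < δ + (1 - σ₁ * Real.cos p.1) / 2 * (t₁ ω)⁻¹ +
      (1 - σ₂ * Real.cos p.2) / 2 * (t₂ ω)⁻¹ := fun p => by
    linarith [hnn₁ p.1, hnn₂ p.2]
  have hpt : ∀ p : ℝ × ℝ, phiB a₃ β ω / (phiB a₃ β ω - fFun a₁ a₂ p.1 p.2 ω) ≤
      1 + (t₁ ω₁ + t₂ ω₁) * (δ + (1 - σ₁ * Real.cos p.1) / 2 * (t₁ ω)⁻¹ +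
        (1 - σ₂ * Real.cos p.2) / 2 * (t₂ ω)⁻¹)⁻¹ := by
    intro p
    have q₁ := halfAngleQuot_le (abs_mul_cos_le_one hσ₁ p.1) p₁
    have q₂ := halfAngleQuot_le (abs_mul_cos_le_one hσ₂ p.2) p₂
    have hfeq := hf ω h₁ h₂ p.1 p.2
    have n₁ := hnn₁ p.1
    have n₂ := hnn₂ p.2
    have hD := hdpos p
    have hden : 0 < phiB a₃ β ω - fFun a₁ a₂ p.1 p.2 ω := sub_pos.2 (hfφ _ _)
    have e₁ : phiB a₃ β ω / (phiB a₃ β ω - fFun a₁ a₂ p.1 p.2 ω) =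
        1 + fFun a₁ a₂ p.1 p.2 ω / (phiB a₃ β ω - fFun a₁ a₂ p.1 p.2 ω) := by
      field_simp
      ring
    rw [e₁, ← div_eq_mul_inv]
    exact add_le_add le_rfl (div_le_div₀ (by linarith) (by linarith) hD (by linarith))
  have hcont : Continuous fun p : ℝ × ℝ => (δ + (1 - σ₁ * Real.cos p.1) / 2 * (t₁ ω)⁻¹ +
      (1 - σ₂ * Real.cos p.2) / 2 * (t₂ ω)⁻¹)⁻¹ :=
    Continuous.inv₀ (by fun_prop) fun p => (hdpos p).ne'
  have hI : IB a₁ a₂ a₃ β ω ≤ 1 + 1 / (4 * π ^ 2) * ((t₁ ω₁ + t₂ ω₁) * e ω) := by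
    have hM := (integrableOn_square hcont).const_mul (t₁ ω₁ + t₂ ω₁)
    have h1 := integrableOn_square (continuous_const (y := (1 : ℝ)))
    have hle := integral_mono (integrableOn_square (continuous_phiB_div (Or.inl hfφ)))
      (h1.add hM) hpt
    simp only [Pi.add_apply] at hle
    rw [integral_add h1 hM, integral_const_mul,
      setIntegral_const, volume_real_square, smul_eq_mul, mul_one] at hle
    have hπ := pi_pos
    calc IB a₁ a₂ a₃ β ω ≤ 1 / (4 * π ^ 2) * (4 * π ^ 2 + (t₁ ω₁ + t₂ ω₁) * e ω) :=
          mul_le_mul_of_nonneg_left hle (by positivity)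
      _ = _ := by
          field_simp
  have hIpos := IB_pos (Or.inl hfφ)
  have hinv : 1 - (IB a₁ a₂ a₃ β ω)⁻¹ ≤ IB a₁ a₂ a₃ β ω - 1 := by
    have h2 : IB a₁ a₂ a₃ β ω + (IB a₁ a₂ a₃ β ω)⁻¹ - 2 =
        (IB a₁ a₂ a₃ β ω - 1) ^ 2 / IB a₁ a₂ a₃ β ω := by
      field_simp
      ring
    have h3 : 0 ≤ (IB a₁ a₂ a₃ β ω - 1) ^ 2 / IB a₁ a₂ a₃ β ω := by positivity
    linarith
  show 1 - FB a₁ a₂ a₃ β ω ≤ _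
  unfold FB
  linarith

/-- in a gap of type (ii), `F_β → 0` at the top of the gap and
`limsup (1 − F_β) ≤ 0` at the bottom. -/
theorem stmt11 (a₁ a₂ a₃ β : ℝ) (ha₁ : 0 < a₁) (ha₂ : 0 < a₂) (ha₃ : 0 < a₃)
    (hβ : β ∈ Icc (0 : ℝ) π) (ωb ωt : ℝ) (hgap : IsGap a₁ a₂ a₃ β ωb ωt)
    (hb : ωb ∈ Tset a₁ a₂) (ht : ωt ∉ Tset a₁ a₂)
    (hW : Ioo ωb ωt ∩ Wset a₃ β = ∅) :
    Tendsto (fun ω => FB a₁ a₂ a₃ β ω) (𝓝[Ioo ωb ωt] ωt) (𝓝 0) ∧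
    limsup (fun ω => 1 - FB a₁ a₂ a₃ β ω) (𝓝[Ioo ωb ωt] ωb) ≤ 0 := by
  obtain ⟨hωb, hlt, -, htmem, hempty⟩ := hgap
  have hnot : ∀ ω ∈ Ioo ωb ωt, ω ∉ dispSet a₁ a₂ a₃ β := fun ω hω h =>
    (hempty ▸ ⟨hω, h⟩ : ω ∈ (∅ : Set ℝ))
  have hωt : 0 < ωt := hωb.trans hlt
  constructor
  · rw [nhdsWithin_Ioo_eq_nhdsLT hlt]
    refine tendsto_FB_zero (nhdsWithin_mono _ fun x hx => ne_of_lt hx) ha₃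
      (sin_mul_ne_zero_of_notMem ha₁ hωt fun h => ht (Or.inl h))
      (sin_mul_ne_zero_of_notMem ha₂ hωt fun h => ht (Or.inr h)) htmem ?_
    filter_upwards [Ioo_mem_nhdsLT hlt] with ω hω
    exact ⟨hωb.trans hω.1, hnot ω hω⟩
  · rw [nhdsWithin_Ioo_eq_nhdsGT hlt]
    exact limsup_one_sub_FB_nonpos ha₁ ha₂ ha₃ hωb hlt
      (hb.imp (sin_mul_eq_zero_of_eq ha₁) (sin_mul_eq_zero_of_eq ha₂)) hnot
end
end

section
/- Let a₁, a₂, a₃ > 0 and β ∈ [0, π], and let (ω_b, ω_t) be a gap of Σ(β). Then for every ω ∈ (ω_b, ω_t) with sin(ω a₃) ≠ 0 one has sin(ω a₁) ≠ 0, sin(ω a₂) ≠ 0 and φ_β(ω) − f(ξ, η, ω) ≠ 0 for all (ξ, η) ∈ [0, 2π]², so that I_β(ω) is well-defined, and the function ω ↦ I_β(ω) is continuous on the set {ω ∈ (ω_b, ω_t) : sin(ω a₃) ≠ 0}. -/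
open Real MeasureTheory Set Filter Topology

noncomputable section

/-- Off the zeros of the sines, `φ_β - f` is the dispersion function divided by the sines. -/
lemma phiB_sub_fFun_eq_Dfun_div {a₁ a₂ a₃ β ω : ℝ} (ξ η : ℝ) (h₁ : Real.sin (ω * a₁) ≠ 0)
    (h₂ : Real.sin (ω * a₂) ≠ 0) (h₃ : Real.sin (ω * a₃) ≠ 0) :
    phiB a₃ β ω - fFun a₁ a₂ ξ η ω = Dfun a₁ a₂ a₃ β ω ξ η /
      (Real.sin (ω * a₁) * Real.sin (ω * a₂) * Real.sin (ω * a₃)) := by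
  unfold phiB fFun Dfun
  field_simp
  ring

/-- The range of the quasimomenta in the dispersion set may be enlarged to all of `ℝ`. -/
lemma mem_dispSet_of_Dfun_eq_zero {a₁ a₂ a₃ β ω ξ η : ℝ} (hω : 0 < ω)
    (h : Dfun a₁ a₂ a₃ β ω ξ η = 0) : ω ∈ dispSet a₁ a₂ a₃ β := by
  refine ⟨hω, Real.arccos (Real.cos ξ), ⟨Real.arccos_nonneg _, Real.arccos_le_pi _⟩,
    Real.arccos (Real.cos η), ⟨Real.arccos_nonneg _, Real.arccos_le_pi _⟩, ?_⟩
  rw [← h, Dfun, Dfun, Real.cos_arccos (Real.neg_one_le_cos _) (Real.cos_le_one _),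
    Real.cos_arccos (Real.neg_one_le_cos _) (Real.cos_le_one _)]

/-- Outside the dispersion set the sines of the first two edges and `φ_β - f` do not vanish. -/
lemma phiB_sub_fFun_ne_zero_of_notMem_dispSet {a₁ a₂ a₃ β ω : ℝ} (hω : 0 < ω)
    (h : ω ∉ dispSet a₁ a₂ a₃ β) (h₃ : Real.sin (ω * a₃) ≠ 0) :
    Real.sin (ω * a₁) ≠ 0 ∧ Real.sin (ω * a₂) ≠ 0 ∧
      ∀ ξ η : ℝ, phiB a₃ β ω - fFun a₁ a₂ ξ η ω ≠ 0 := by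
  have h₁ : Real.sin (ω * a₁) ≠ 0 := fun h0 =>
    h (mem_dispSet_of_Dfun_eq_zero (ξ := ω * a₁) (η := 0) hω (by simp [Dfun, h0]))
  have h₂ : Real.sin (ω * a₂) ≠ 0 := fun h0 =>
    h (mem_dispSet_of_Dfun_eq_zero (ξ := 0) (η := ω * a₂) hω (by simp [Dfun, h0]))
  refine ⟨h₁, h₂, fun ξ η => ?_⟩
  rw [phiB_sub_fFun_eq_Dfun_div ξ η h₁ h₂ h₃]
  exact div_ne_zero (fun h0 => h (mem_dispSet_of_Dfun_eq_zero hω h0)) (by positivity)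

/-- `I_β` is continuous on every open set on which no denominator vanishes. -/
lemma continuousOn_IB {a₁ a₂ a₃ β : ℝ} {S : Set ℝ} (hS : IsOpen S)
    (h₁ : ∀ ω ∈ S, Real.sin (ω * a₁) ≠ 0) (h₂ : ∀ ω ∈ S, Real.sin (ω * a₂) ≠ 0)
    (h₃ : ∀ ω ∈ S, Real.sin (ω * a₃) ≠ 0)
    (h : ∀ ω ∈ S, ∀ ξ η : ℝ, phiB a₃ β ω - fFun a₁ a₂ ξ η ω ≠ 0) :
    ContinuousOn (IB a₁ a₂ a₃ β) S := by
  have : LocallyCompactSpace S := hS.locallyCompactSpace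
  have hset : (Ioo (0 : ℝ) (2 * π) ×ˢ Ioo (0 : ℝ) (2 * π) : Set (ℝ × ℝ)) =ᵐ[volume]
      (Icc (0 : ℝ) (2 * π) ×ˢ Icc (0 : ℝ) (2 * π) : Set (ℝ × ℝ)) :=
    Measure.set_prod_ae_eq Ioo_ae_eq_Icc Ioo_ae_eq_Icc
  rw [continuousOn_iff_continuous_domRestrict]
  simp only [domRestrict_def, IB, setIntegral_congr_set hset]
  refine continuous_const.mul
    (continuous_parametric_integral_of_continuous ?_ (isCompact_Icc.prod isCompact_Icc))
  have hφ : Continuous fun q : S × (ℝ × ℝ) => phiB a₃ β q.1 := by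
    unfold phiB
    exact Continuous.div (by fun_prop) (by fun_prop) fun q => h₃ _ q.1.2
  have hf : Continuous fun q : S × (ℝ × ℝ) => fFun a₁ a₂ q.2.1 q.2.2 q.1 := by
    unfold fFun
    exact (Continuous.div (by fun_prop) (by fun_prop) fun q => h₁ _ q.1.2).add
      (Continuous.div (by fun_prop) (by fun_prop) fun q => h₂ _ q.1.2)
  exact hφ.div (hφ.sub hf) fun q => h _ q.1.2 _ _

/-- inside a gap, the denominator never vanishes and `I_β` is
well-defined and continuous. -/
theorem stmt13 (a₁ a₂ a₃ β : ℝ) (ha₁ : 0 < a₁) (ha₂ : 0 < a₂) (ha₃ : 0 < a₃)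
    (hβ : β ∈ Icc (0 : ℝ) π) (ωb ωt : ℝ) (hgap : IsGap a₁ a₂ a₃ β ωb ωt) :
    (∀ ω ∈ Ioo ωb ωt, Real.sin (ω * a₃) ≠ 0 →
      Real.sin (ω * a₁) ≠ 0 ∧ Real.sin (ω * a₂) ≠ 0 ∧
        ∀ ξ ∈ Icc (0 : ℝ) (2 * π), ∀ η ∈ Icc (0 : ℝ) (2 * π),
          phiB a₃ β ω - fFun a₁ a₂ ξ η ω ≠ 0) ∧
    ContinuousOn (fun ω => IB a₁ a₂ a₃ β ω)
      {ω | ω ∈ Ioo ωb ωt ∧ Real.sin (ω * a₃) ≠ 0} := by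
  obtain ⟨hωb, -, -, -, hdisj⟩ := hgap
  have key : ∀ ω ∈ Ioo ωb ωt, Real.sin (ω * a₃) ≠ 0 →
      Real.sin (ω * a₁) ≠ 0 ∧ Real.sin (ω * a₂) ≠ 0 ∧
        ∀ ξ η : ℝ, phiB a₃ β ω - fFun a₁ a₂ ξ η ω ≠ 0 := fun ω hω =>
    phiB_sub_fFun_ne_zero_of_notMem_dispSet (hωb.trans hω.1)
      fun hmem => notMem_empty ω (hdisj ▸ ⟨hω, hmem⟩)
  refine ⟨fun ω hω h₃ => ?_, ?_⟩
  · obtain ⟨h₁, h₂, h⟩ := key ω hω h₃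
    exact ⟨h₁, h₂, fun ξ _ η _ => h ξ η⟩
  · refine continuousOn_IB ?_ (fun ω hω => (key ω hω.1 hω.2).1)
      (fun ω hω => (key ω hω.1 hω.2).2.1) (fun ω hω => hω.2)
      (fun ω hω => (key ω hω.1 hω.2).2.2)
    exact isOpen_Ioo.inter (isOpen_ne_fun (by fun_prop) continuous_const)
end
end

section
/- Let a₁, a₂, a₃ > 0, β ∈ [0, π] and 0 < μ < 1. Let (ω_b, ω_t) be a gap of Σ(β) of type (i) with distinguished point ω₀ ∈ (ω_b, ω_t) ∩ 𝒲(β). Then there exist ω₁ ∈ (ω_b, ω₀) and ω₂ ∈ (ω₀, ω_t) such that for each j ∈ {1, 2} there is a square-summable u : ℤ² → ℂ, not identically zero, satisfying the system (FD) with frequency ω_j; equivalently μ = 1 − F_β(ω_j) for j = 1, 2. (The perturbed operator 𝒜^μ(β) has at least two eigenvalues ω₁² and ω₂² in a gap of type (i).) -/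
open Real MeasureTheory Set Filter Topology

noncomputable section

/-- Lebesgue measure on the period square `(0, 2π)²`. -/
def squareMeasure : Measure (ℝ × ℝ) :=
  volume.restrict (Ioo (0 : ℝ) (2 * π) ×ˢ Ioo (0 : ℝ) (2 * π))

lemma Continuous.integrable_squareMeasure {E : Type*} [NormedAddCommGroup E]
    {F : ℝ × ℝ → E} (hF : Continuous F) : Integrable F squareMeasure := by
  have h : IntegrableOn F (Icc (0 : ℝ) (2 * π) ×ˢ Icc (0 : ℝ) (2 * π)) volume :=
    hF.continuousOn.integrableOn_compact (isCompact_Icc.prod isCompact_Icc)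
  exact h.mono_set (prod_mono Ioo_subset_Icc_self Ioo_subset_Icc_self)

instance : IsFiniteMeasure squareMeasure := by
  have h := (continuous_const (y := (1 : ℝ))).integrable_squareMeasure
  rw [integrable_const_iff] at h
  simpa using h

lemma squareMeasure_real_univ : squareMeasure.real univ = 4 * π ^ 2 := by
  have hp := Real.pi_pos
  rw [squareMeasure, measureReal_restrict_apply_univ, Measure.volume_eq_prod,
    measureReal_prod_prod, Real.volume_real_Ioo_of_le (by positivity)]
  ring

/-- The character `(x, y) ↦ exp (i (n₁ x + n₂ y))`. -/
def torusChar (n : ℤ × ℤ) (p : ℝ × ℝ) : ℂ :=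
  Complex.exp (Complex.I * (n.1 * p.1)) * Complex.exp (Complex.I * (n.2 * p.2))

lemma continuous_torusChar (n : ℤ × ℤ) : Continuous (torusChar n) := by
  unfold torusChar
  fun_prop

lemma integral_exp_I_mul (n : ℤ) :
    ∫ x in Ioo (0 : ℝ) (2 * π), Complex.exp (Complex.I * (n * x))
      = if n = 0 then (2 * π : ℂ) else 0 := by
  have hp := Real.pi_pos
  rw [← integral_Ioc_eq_integral_Ioo, ← intervalIntegral.integral_of_le (by positivity)]
  split_ifs with h
  · simp [h]
  · have hc : Complex.I * n ≠ 0 := mul_ne_zero Complex.I_ne_zero (by exact_mod_cast h)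
    have := integral_exp_mul_complex (a := 0) (b := 2 * π) hc
    simp only [mul_assoc] at this
    rw [this]
    have h1 : Complex.exp (Complex.I * (n * ((2 * π : ℝ) : ℂ))) = 1 := by
      rw [Complex.exp_eq_one_iff]
      exact ⟨n, by push_cast; ring⟩
    rw [h1]
    simp

lemma integral_torusChar (n : ℤ × ℤ) :
    ∫ p, torusChar n p ∂squareMeasure = if n = 0 then (4 * π ^ 2 : ℂ) else 0 := by
  unfold torusChar squareMeasure
  rw [Measure.volume_eq_prod,
    setIntegral_prod_mul (fun x : ℝ => Complex.exp (Complex.I * (n.1 * x)))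
      (fun y : ℝ => Complex.exp (Complex.I * (n.2 * y))),
    integral_exp_I_mul, integral_exp_I_mul]
  by_cases h1 : n.1 = 0 <;> by_cases h2 : n.2 = 0 <;> simp [Prod.ext_iff, h1, h2]
  ring

lemma conj_torusChar_mul (m n : ℤ × ℤ) (p : ℝ × ℝ) :
    (starRingEnd ℂ) (torusChar m p) * torusChar n p = torusChar (n - m) p := by
  simp only [torusChar, ← Complex.exp_conj, ← Complex.exp_add, Prod.fst_sub, Prod.snd_sub]
  congr 1
  simp only [map_add, map_mul, Complex.conj_I, Complex.conj_ofReal, map_intCast]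
  push_cast
  ring

lemma Continuous.memLp_two_squareMeasure {F : ℝ × ℝ → ℂ} (hF : Continuous F) :
    MemLp F 2 squareMeasure :=
  (memLp_two_iff_integrable_sq_norm hF.aestronglyMeasurable).2
    (hF.norm.pow 2).integrable_squareMeasure

lemma summable_norm_sq_integral_torusChar_mul {F : ℝ × ℝ → ℂ} (hF : Continuous F) :
    Summable fun n : ℤ × ℤ => ‖∫ p, torusChar n p * F p ∂squareMeasure‖ ^ 2 := by
  have hp : (2 * π : ℂ) ≠ 0 := by exact_mod_cast Real.two_pi_pos.ne'
  have hcont (n : ℤ × ℤ) : Continuous fun p => (2 * π : ℂ)⁻¹ * torusChar (-n) p :=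
    continuous_const.mul (continuous_torusChar _)
  have hinner (n : ℤ × ℤ) {G : ℝ × ℝ → ℂ} (hG : Continuous G) :
      inner ℂ ((hcont n).memLp_two_squareMeasure.toLp _) (hG.memLp_two_squareMeasure.toLp _)
        = (2 * π : ℂ)⁻¹ * ∫ p, torusChar n p * G p ∂squareMeasure := by
    rw [L2.inner_def, ← integral_const_mul]
    refine integral_congr_ae ?_
    filter_upwards [(hcont n).memLp_two_squareMeasure.coeFn_toLp,
      hG.memLp_two_squareMeasure.coeFn_toLp] with p h1 h2
    have h3 := conj_torusChar_mul (-n) 0 p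
    rw [h1, h2, RCLike.inner_apply]
    have h4 : torusChar 0 p = 1 := by simp [torusChar]
    rw [h4, mul_one, zero_sub, neg_neg] at h3
    rw [map_mul, h3, map_inv₀, map_mul, Complex.conj_ofReal, map_ofNat]
    ring
  have hon : Orthonormal ℂ fun n : ℤ × ℤ => (hcont n).memLp_two_squareMeasure.toLp _ := by
    rw [orthonormal_iff_ite]
    intro m n
    rw [hinner m (hcont n)]
    have h5 (p : ℝ × ℝ) : torusChar m p * ((2 * π : ℂ)⁻¹ * torusChar (-n) p)
        = (2 * π : ℂ)⁻¹ * torusChar (m - n) p := by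
      rw [← conj_torusChar_mul, ← zero_sub n, ← conj_torusChar_mul]
      simp [torusChar]
      ring
    simp only [h5]
    rw [integral_const_mul, integral_torusChar]
    simp only [sub_eq_zero]
    split_ifs
    · field_simp
      norm_num
    · simp
  have hs := (hon.inner_products_summable (hF.memLp_two_squareMeasure.toLp _)).mul_left
    (‖(2 * π : ℂ)‖ ^ 2)
  refine hs.congr fun n => ?_
  rw [hinner n hF, ← mul_pow, ← norm_mul, mul_inv_cancel_left₀ hp]

lemma abs_cos_div_add_cos_div_le (s t : ℝ) (x y : ℝ) :
    |cos x / s + cos y / t| ≤ 1 / |s| + 1 / |t| := by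
  refine (abs_add_le _ _).trans ?_
  rw [abs_div, abs_div]
  gcongr <;> exact abs_cos_le_one _

lemma sub_le_abs_symbol (s t g : ℝ) (p : ℝ × ℝ) :
    |g| - (1 / |s| + 1 / |t|) ≤ |g - (cos p.1 / s + cos p.2 / t)| := by
  have := abs_sub_abs_le_abs_sub g (cos p.1 / s + cos p.2 / t)
  linarith [abs_cos_div_add_cos_div_le s t p.1 p.2]

lemma integral_add₄_sub {α : Type*} [MeasurableSpace α] {ν : Measure α} {f₁ f₂ f₃ f₄ f₅ : α → ℂ}
    (h₁ : Integrable f₁ ν) (h₂ : Integrable f₂ ν) (h₃ : Integrable f₃ ν) (h₄ : Integrable f₄ ν)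
    (h₅ : Integrable f₅ ν) :
    ∫ x, f₁ x + f₂ x + f₃ x + f₄ x - f₅ x ∂ν
      = (∫ x, f₁ x ∂ν) + (∫ x, f₂ x ∂ν) + (∫ x, f₃ x ∂ν) + (∫ x, f₄ x ∂ν) - ∫ x, f₅ x ∂ν := by
  rw [integral_sub (((h₁.fun_add h₂).fun_add h₃).fun_add h₄) h₅,
    integral_add ((h₁.fun_add h₂).fun_add h₃) h₄, integral_add (h₁.fun_add h₂) h₃,
    integral_add h₁ h₂]

/-- The Fourier coefficients of the reciprocal symbol give a square-summable Green's function. -/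
lemma exists_green_function {s t g : ℝ} (hg : 1 / |s| + 1 / |t| < |g|) :
    ∃ u : ℤ × ℤ → ℂ, (Summable fun n => ‖u n‖ ^ 2) ∧
      u (0, 0) = ((∫ p, (g - (cos p.1 / s + cos p.2 / t))⁻¹ ∂squareMeasure : ℝ) : ℂ) ∧
      ∀ k l : ℤ, u (k + 1, l) / (s : ℂ) + u (k - 1, l) / (s : ℂ)
        + u (k, l + 1) / (t : ℂ) + u (k, l - 1) / (t : ℂ) - 2 * (g : ℂ) * u (k, l)
        = if (k, l) = ((0 : ℤ), (0 : ℤ)) then -(8 * π ^ 2 : ℂ) else 0 := by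
  set K : ℝ × ℝ → ℝ := fun p => g - (cos p.1 / s + cos p.2 / t) with hKdef
  have hK0 (p : ℝ × ℝ) : K p ≠ 0 := by
    rw [← abs_pos]
    linarith [sub_le_abs_symbol s t g p]
  have hKc : Continuous K := by fun_prop
  have hG : Continuous fun p => (((K p)⁻¹ : ℝ) : ℂ) :=
    Complex.continuous_ofReal.comp (hKc.inv₀ hK0)
  have hint (n : ℤ × ℤ) : Integrable (fun p => torusChar n p * (((K p)⁻¹ : ℝ) : ℂ))
      squareMeasure := ((continuous_torusChar n).mul hG).integrable_squareMeasure
  refine ⟨fun n => ∫ p, torusChar n p * (((K p)⁻¹ : ℝ) : ℂ) ∂squareMeasure,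
    summable_norm_sq_integral_torusChar_mul hG, ?_, fun k l => ?_⟩
  · rw [← integral_complex_ofReal]
    simp [torusChar, hKdef]
  · have hpt (p : ℝ × ℝ) : torusChar (k + 1, l) p * (((K p)⁻¹ : ℝ) : ℂ) / (s : ℂ)
        + torusChar (k - 1, l) p * (((K p)⁻¹ : ℝ) : ℂ) / (s : ℂ)
        + torusChar (k, l + 1) p * (((K p)⁻¹ : ℝ) : ℂ) / (t : ℂ)
        + torusChar (k, l - 1) p * (((K p)⁻¹ : ℝ) : ℂ) / (t : ℂ)
        - 2 * (g : ℂ) * (torusChar (k, l) p * (((K p)⁻¹ : ℝ) : ℂ))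
        = -2 * torusChar (k, l) p := by
      have hKC : (K p : ℂ) * (((K p)⁻¹ : ℝ) : ℂ) = 1 := by
        rw [← Complex.ofReal_mul, mul_inv_cancel₀ (hK0 p), Complex.ofReal_one]
      have hc (x : ℝ) : Complex.exp (Complex.I * x) + Complex.exp (-(Complex.I * x))
          = 2 * (cos x : ℂ) := by
        rw [Complex.ofReal_cos, Complex.cos]
        ring_nf
      have e1 : torusChar (k + 1, l) p + torusChar (k - 1, l) p
          = torusChar (k, l) p * (2 * (cos p.1 : ℂ)) := by
        rw [← hc]
        simp only [torusChar, Int.cast_add, Int.cast_one, add_mul, mul_add, sub_eq_add_neg,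
          Complex.exp_add, one_mul]
        ring_nf
      have e2 : torusChar (k, l + 1) p + torusChar (k, l - 1) p
          = torusChar (k, l) p * (2 * (cos p.2 : ℂ)) := by
        rw [← hc]
        simp only [torusChar, Int.cast_add, Int.cast_one, add_mul, mul_add, sub_eq_add_neg,
          Complex.exp_add, one_mul]
        ring_nf
      have hKp : (K p : ℂ) = g - ((cos p.1 : ℂ) / s + (cos p.2 : ℂ) / t) := by
        simp only [hKdef]
        push_cast
        ring
      rw [hKp] at hKC
      linear_combination (((K p)⁻¹ : ℝ) : ℂ) / s * e1 + (((K p)⁻¹ : ℝ) : ℂ) / t * e2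
        - 2 * torusChar (k, l) p * hKC
    have h := congrArg (fun F => ∫ p, F p ∂squareMeasure) (funext hpt)
    beta_reduce at h
    rw [integral_const_mul, integral_torusChar, integral_add₄_sub ((hint _).div_const _)
      ((hint _).div_const _) ((hint _).div_const _) ((hint _).div_const _)
      ((hint _).const_mul _), integral_div, integral_div, integral_div, integral_div,
      integral_const_mul] at h
    rw [h]
    simp only [← Prod.mk_zero_zero]
    split_ifs <;> ring

/-- The integral of `φ / (g - cos x / s - cos y / t)` over the period square. -/
def symbolIntegral (s t g φ : ℝ) : ℝ :=
  ∫ p, φ / (g - (cos p.1 / s + cos p.2 / t)) ∂squareMeasure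

lemma measurable_div_symbol (s t g φ : ℝ) :
    Measurable fun p : ℝ × ℝ => φ / (g - (cos p.1 / s + cos p.2 / t)) := by
  fun_prop

lemma continuousOn_symbolIntegral {S : Set ℝ} {s t g φ : ℝ → ℝ} (hs : ContinuousOn s S)
    (ht : ContinuousOn t S) (hg : ContinuousOn g S) (hφ : ContinuousOn φ S)
    (hs0 : ∀ ω ∈ S, s ω ≠ 0) (ht0 : ∀ ω ∈ S, t ω ≠ 0)
    (hgap : ∀ ω ∈ S, 1 / |s ω| + 1 / |t ω| < |g ω|) :
    ContinuousOn (fun ω => symbolIntegral (s ω) (t ω) (g ω) (φ ω)) S := by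
  intro ω hω
  set δ : ℝ → ℝ := fun ω => |φ ω| / (|g ω| - (1 / |s ω| + 1 / |t ω|)) with hδ
  have hδc : ContinuousWithinAt δ S ω := by
    refine (hφ ω hω).abs.div ((hg ω hω).abs.sub
      (((continuousWithinAt_const).div (hs ω hω).abs ?_).add
      ((continuousWithinAt_const).div (ht ω hω).abs ?_))) ?_
    · exact abs_ne_zero.2 (hs0 ω hω)
    · exact abs_ne_zero.2 (ht0 ω hω)
    · exact (sub_pos.2 (hgap ω hω)).ne'
  refine continuousWithinAt_of_dominated (bound := fun _ => δ ω + 1) ?_ ?_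
    (integrable_const _) ?_
  · exact Eventually.of_forall fun x => (measurable_div_symbol _ _ _ _).aestronglyMeasurable
  · filter_upwards [hδc.eventually (gt_mem_nhds (lt_add_one (δ ω))), self_mem_nhdsWithin]
      with x hx hxS
    refine Eventually.of_forall fun p => ?_
    refine le_trans ?_ hx.le
    rw [norm_eq_abs, abs_div]
    have h1 := hgap x hxS
    exact div_le_div_of_nonneg_left (abs_nonneg _) (by linarith) (sub_le_abs_symbol _ _ _ _)
  · refine Eventually.of_forall fun p => ?_
    refine (hφ ω hω).div ((hg ω hω).sub ((continuousWithinAt_const.div (hs ω hω) (hs0 ω hω)).add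
      (continuousWithinAt_const.div (ht ω hω) (ht0 ω hω)))) ?_
    rw [← abs_pos]
    linarith [sub_le_abs_symbol (s ω) (t ω) (g ω) p, hgap ω hω]

lemma tendsto_symbolIntegral_of_inv_tendsto_zero {l : Filter ℝ} [l.IsCountablyGenerated]
    {s t r φ : ℝ → ℝ} {s₀ t₀ r₀ : ℝ} (hs : Tendsto s l (𝓝 s₀)) (ht : Tendsto t l (𝓝 t₀))
    (hr : Tendsto r l (𝓝 r₀)) (hs0 : s₀ ≠ 0) (ht0 : t₀ ≠ 0) (hφ0 : ∀ᶠ ω in l, φ ω ≠ 0)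
    (hφ : Tendsto (fun ω => (φ ω)⁻¹) l (𝓝 0)) :
    Tendsto (fun ω => symbolIntegral (s ω) (t ω) (r ω + φ ω) (φ ω)) l (𝓝 (4 * π ^ 2)) := by
  have hlim : 4 * π ^ 2 = ∫ _ : ℝ × ℝ, (1 : ℝ) ∂squareMeasure := by
    rw [integral_const, squareMeasure_real_univ, smul_eq_mul, mul_one]
  have hform {ω : ℝ} (h : φ ω ≠ 0) (p : ℝ × ℝ) :
      φ ω / (r ω + φ ω - (cos p.1 / s ω + cos p.2 / t ω))
        = (1 + (r ω - (cos p.1 / s ω + cos p.2 / t ω)) * (φ ω)⁻¹)⁻¹ := by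
    have : r ω + φ ω - (cos p.1 / s ω + cos p.2 / t ω)
        = φ ω * (1 + (r ω - (cos p.1 / s ω + cos p.2 / t ω)) * (φ ω)⁻¹) := by
      field_simp
      ring
    rw [this, ← div_div, div_self h, one_div]
  have hsmall : ∀ᶠ ω in l, (|r ω| + (1 / |s ω| + 1 / |t ω|)) * |(φ ω)⁻¹| < 1 / 2 := by
    have h : Tendsto (fun ω => (|r ω| + (1 / |s ω| + 1 / |t ω|)) * |(φ ω)⁻¹|) l
        (𝓝 ((|r₀| + (1 / |s₀| + 1 / |t₀|)) * |0|)) :=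
      (hr.abs.add ((tendsto_const_nhds.div hs.abs (abs_ne_zero.2 hs0)).add
        (tendsto_const_nhds.div ht.abs (abs_ne_zero.2 ht0)))).mul hφ.abs
    rw [abs_zero, mul_zero] at h
    exact h.eventually (gt_mem_nhds (by norm_num))
  rw [hlim]
  refine tendsto_integral_filter_of_dominated_convergence (fun _ => 2) ?_ ?_
    (integrable_const _) ?_
  · exact Eventually.of_forall fun x => (measurable_div_symbol _ _ _ _).aestronglyMeasurable
  · filter_upwards [hφ0, hsmall] with ω h0 hsm
    refine Eventually.of_forall fun p => ?_
    rw [hform h0, norm_inv, norm_eq_abs]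
    have h1 : |(r ω - (cos p.1 / s ω + cos p.2 / t ω)) * (φ ω)⁻¹| ≤ 1 / 2 := by
      rw [abs_mul]
      refine (mul_le_mul_of_nonneg_right ?_ (abs_nonneg _)).trans hsm.le
      exact (abs_sub _ _).trans (by gcongr; exact abs_cos_div_add_cos_div_le _ _ _ _)
    have h2 : (2 : ℝ)⁻¹ ≤ |1 + (r ω - (cos p.1 / s ω + cos p.2 / t ω)) * (φ ω)⁻¹| := by
      refine le_trans ?_ (le_abs_self _)
      linarith [(abs_le.1 h1).1]
    exact inv_le_of_inv_le₀ (by norm_num) h2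
  · refine Eventually.of_forall fun p => ?_
    have h : Tendsto (fun ω => (1 + (r ω - (cos p.1 / s ω + cos p.2 / t ω)) * (φ ω)⁻¹)⁻¹) l
        (𝓝 ((1 + (r₀ - (cos p.1 / s₀ + cos p.2 / t₀)) * 0)⁻¹)) := by
      refine ((((hr.sub ((tendsto_const_nhds.div hs hs0).add
        (tendsto_const_nhds.div ht ht0))).mul hφ).const_add 1).inv₀ ?_)
      simp
    rw [mul_zero, add_zero, inv_one] at h
    exact h.congr' (hφ0.mono fun ω h0 => (hform h0 p).symm)

lemma lintegral_inv_sub_Ioo_eq_top {κ : ℝ} (hκ : 0 < κ) (c : ℝ) :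
    ∫⁻ x in Ioo c (c + 1), ENNReal.ofReal (κ * (x - c)⁻¹) = ⊤ := by
  by_contra h
  have hnn : 0 ≤ᵐ[volume.restrict (Ioo c (c + 1))] fun x : ℝ => κ * (x - c)⁻¹ := by
    filter_upwards [ae_restrict_mem measurableSet_Ioo] with x hx
    have := sub_pos.2 hx.1
    simp only [Pi.zero_apply]
    positivity
  rw [← ne_eq, lintegral_ofReal_ne_top_iff_integrable (by fun_prop) hnn] at h
  have h2 : IntervalIntegrable (fun x => (x - c)⁻¹) volume c (c + 1) := by
    rw [intervalIntegrable_iff_integrableOn_Ioo_of_le (by linarith)]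
    refine (h.const_mul κ⁻¹).congr (Eventually.of_forall fun x => ?_)
    simp [hκ.ne']
  rw [intervalIntegrable_sub_inv_iff] at h2
  rcases h2 with h2 | h2
  · linarith
  · exact h2 left_mem_uIcc

lemma exists_cos_add_div_eq {s ε : ℝ} (hs : s ≠ 0) (hε : ε = 1 ∨ ε = -1) :
    ∃ x₀ ∈ Icc (0 : ℝ) π, ∀ x, cos (x₀ + x) / s = ε / |s| * cos x := by
  have hp := Real.pi_pos.le
  rcases hs.lt_or_gt with h | h <;> rcases hε with rfl | rfl
  · exact ⟨π, ⟨hp, le_rfl⟩, fun x => by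
      rw [abs_of_neg h, add_comm, cos_add_pi]; field_simp⟩
  · exact ⟨0, ⟨le_rfl, hp⟩, fun x => by rw [abs_of_neg h, zero_add]; field_simp⟩
  · exact ⟨0, ⟨le_rfl, hp⟩, fun x => by rw [abs_of_pos h, zero_add]; field_simp⟩
  · exact ⟨π, ⟨hp, le_rfl⟩, fun x => by
      rw [abs_of_pos h, add_comm, cos_add_pi]; field_simp⟩

/-- At the edge of the range of the symbol the singularity of `1 / symbol` is quadratic, hence not
integrable in two dimensions. The points outside the zero set of the symbol suffice. -/
lemma exists_lintegral_symbol_eq_top {s t g φ : ℝ} (hs : s ≠ 0) (ht : t ≠ 0) (hφ : φ ≠ 0)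
    (hg : |g| = 1 / |s| + 1 / |t|) :
    ∃ Q ⊆ Ioo (0 : ℝ) (2 * π) ×ˢ Ioo (0 : ℝ) (2 * π), MeasurableSet Q ∧
      (∀ p ∈ Q, g - (cos p.1 / s + cos p.2 / t) ≠ 0) ∧
      ∫⁻ p in Q, ‖φ / (g - (cos p.1 / s + cos p.2 / t))‖ₑ = ⊤ := by
  have hA : 0 < 1 / |s| := by positivity
  have hB : 0 < 1 / |t| := by positivity
  obtain ⟨ε, hε, hgε⟩ : ∃ ε : ℝ, (ε = 1 ∨ ε = -1) ∧ g = ε * (1 / |s| + 1 / |t|) := by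
    rcases abs_choice g with h | h
    · exact ⟨1, .inl rfl, by linarith⟩
    · exact ⟨-1, .inr rfl, by linarith⟩
  obtain ⟨x₀, hx₀, hx⟩ := exists_cos_add_div_eq hs hε
  obtain ⟨y₀, hy₀, hy⟩ := exists_cos_add_div_eq ht hε
  have hεabs : |ε| = 1 := by rcases hε with rfl | rfl <;> simp
  have hsymb (p : ℝ × ℝ) : |g - (cos p.1 / s + cos p.2 / t)|
      = 1 / |s| * (1 - cos (p.1 - x₀)) + 1 / |t| * (1 - cos (p.2 - y₀)) := by
    have h1 := hx (p.1 - x₀)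
    have h2 := hy (p.2 - y₀)
    rw [add_sub_cancel] at h1 h2
    have : g - (cos p.1 / s + cos p.2 / t)
      = ε * (1 / |s| * (1 - cos (p.1 - x₀)) + 1 / |t| * (1 - cos (p.2 - y₀))) := by
      rw [h1, h2, hgε]; ring
    rw [this, abs_mul, hεabs, one_mul, abs_of_nonneg]
    have := cos_le_one (p.1 - x₀)
    have := cos_le_one (p.2 - y₀)
    exact add_nonneg (mul_nonneg hA.le (by linarith)) (mul_nonneg hB.le (by linarith))
  have hp := Real.pi_gt_three
  have hcos {z : ℝ} (h0 : 0 < z) (h1 : z < 1) : cos z < 1 := by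
    have := cos_lt_cos_of_nonneg_of_le_pi le_rfl (by linarith) h0
    rwa [cos_zero] at this
  have hpos {p : ℝ × ℝ} (hpQ : p ∈ Ioo x₀ (x₀ + 1) ×ˢ Ioo y₀ (y₀ + 1)) :
      0 < |g - (cos p.1 / s + cos p.2 / t)| := by
    obtain ⟨⟨h1, h2⟩, h3, h4⟩ := hpQ
    rw [hsymb]
    have := hcos (sub_pos.2 h1) (by linarith)
    have := hcos (sub_pos.2 h3) (by linarith)
    exact add_pos (mul_pos hA (by linarith)) (mul_pos hB (by linarith))
  refine ⟨Ioo x₀ (x₀ + 1) ×ˢ Ioo y₀ (y₀ + 1), ?_, measurableSet_Ioo.prod measurableSet_Ioo,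
    fun p hpQ => abs_pos.1 (hpos hpQ), ?_⟩
  · refine prod_mono (Ioo_subset_Ioo hx₀.1 ?_) (Ioo_subset_Ioo hy₀.1 ?_)
    · linarith [hx₀.2]
    · linarith [hy₀.2]
  set κ : ℝ := 2 * |φ| / (1 / |s| + 1 / |t|) with hκ
  have hκ0 : 0 < κ := by positivity
  rw [eq_top_iff, ← lintegral_inv_sub_Ioo_eq_top hκ0 x₀, Measure.volume_eq_prod,
    ← Measure.prod_restrict, lintegral_prod _ (measurable_div_symbol s t g φ).enorm.aemeasurable]
  refine setLIntegral_mono' measurableSet_Ioo fun x hxI => ?_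
  have hx0 : 0 < x - x₀ := sub_pos.2 hxI.1
  have hsub : Ioo y₀ (y₀ + (x - x₀)) ⊆ Ioo y₀ (y₀ + 1) :=
    Ioo_subset_Ioo_right (by linarith [hxI.2])
  calc ENNReal.ofReal (κ * (x - x₀)⁻¹)
      = ∫⁻ _ in Ioo y₀ (y₀ + (x - x₀)), ENNReal.ofReal (κ / (x - x₀) ^ 2) := by
        rw [setLIntegral_const, Real.volume_Ioo, ← ENNReal.ofReal_mul (by positivity)]
        congr 1
        rw [add_sub_cancel_left]
        field_simp
    _ ≤ ∫⁻ y in Ioo y₀ (y₀ + (x - x₀)), ‖φ / (g - (cos x / s + cos y / t))‖ₑ := by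
        refine setLIntegral_mono' measurableSet_Ioo fun y hyI => ?_
        rw [Real.enorm_eq_ofReal_abs, abs_div]
        refine ENNReal.ofReal_le_ofReal ?_
        have hpp := hpos (p := (x, y)) ⟨hxI, hsub hyI⟩
        have hub : |g - (cos x / s + cos y / t)|
            ≤ (1 / |s| + 1 / |t|) * (x - x₀) ^ 2 / 2 := by
          have h1 := one_sub_sq_div_two_le_cos (x := x - x₀)
          have h2 := one_sub_sq_div_two_le_cos (x := y - y₀)
          have h3 : (y - y₀) ^ 2 ≤ (x - x₀) ^ 2 := by
            exact pow_le_pow_left₀ (by linarith [hyI.1]) (by linarith [hyI.2]) 2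
          have h4 := mul_le_mul_of_nonneg_left
            (show 1 - cos (x - x₀) ≤ (x - x₀) ^ 2 / 2 by linarith) hA.le
          have h5 := mul_le_mul_of_nonneg_left
            (show 1 - cos (y - y₀) ≤ (x - x₀) ^ 2 / 2 by linarith) hB.le
          have := hsymb (x, y)
          simp only at this
          rw [this]
          linarith
        calc κ / (x - x₀) ^ 2 = |φ| / ((1 / |s| + 1 / |t|) * (x - x₀) ^ 2 / 2) := by
              rw [hκ]; field_simp
          _ ≤ _ := div_le_div_of_nonneg_left (abs_nonneg _) hpp hub
    _ ≤ _ := lintegral_mono_set hsub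

lemma eventually_lt_symbolIntegral {l : Filter ℝ} [l.IsCountablyGenerated]
    {s t g φ : ℝ → ℝ} {s₀ t₀ g₀ φ₀ : ℝ} (hs : Tendsto s l (𝓝 s₀)) (ht : Tendsto t l (𝓝 t₀))
    (hg : Tendsto g l (𝓝 g₀)) (hφ : Tendsto φ l (𝓝 φ₀)) (hs0 : s₀ ≠ 0) (ht0 : t₀ ≠ 0)
    (hφ0 : φ₀ ≠ 0) (hg0 : |g₀| = 1 / |s₀| + 1 / |t₀|)
    (hgap : ∀ᶠ ω in l, 1 / |s ω| + 1 / |t ω| < |g ω|)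
    (hpos : ∀ᶠ ω in l, ∀ p : ℝ × ℝ, 0 ≤ φ ω / (g ω - (cos p.1 / s ω + cos p.2 / t ω)))
    (C : ℝ) : ∀ᶠ ω in l, C < symbolIntegral (s ω) (t ω) (g ω) (φ ω) := by
  rcases l.eq_or_neBot with rfl | hl
  · simp
  obtain ⟨Q, hQ, hQm, hQ0, hQtop⟩ := exists_lintegral_symbol_eq_top hs0 ht0 hφ0 hg0
  have hlim : liminf (fun ω => ∫⁻ p in Q, ‖φ ω / (g ω - (cos p.1 / s ω + cos p.2 / t ω))‖ₑ) l
      = ⊤ := by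
    rw [eq_top_iff, ← hQtop]
    refine le_trans (setLIntegral_mono' hQm fun p hp => ?_)
      (lintegral_liminf_le fun ω => (measurable_div_symbol _ _ _ _).enorm)
    refine (Tendsto.liminf_eq (Tendsto.enorm ?_)).ge
    exact hφ.div (hg.sub ((tendsto_const_nhds.div hs hs0).add (tendsto_const_nhds.div ht ht0)))
      (hQ0 p hp)
  have hev := eventually_lt_of_lt_liminf (hlim ▸ ENNReal.ofReal_lt_top (r := C))
  filter_upwards [hev, hgap, hpos] with ω h1 h2 h3
  have hc : Continuous fun p : ℝ × ℝ => φ ω / (g ω - (cos p.1 / s ω + cos p.2 / t ω)) := by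
    refine continuous_const.div (by fun_prop) fun p => abs_pos.1 ?_
    linarith [sub_le_abs_symbol (s ω) (t ω) (g ω) p]
  have h4 : ENNReal.ofReal (symbolIntegral (s ω) (t ω) (g ω) (φ ω))
      = ∫⁻ p, ‖φ ω / (g ω - (cos p.1 / s ω + cos p.2 / t ω))‖ₑ ∂squareMeasure := by
    rw [symbolIntegral, ofReal_integral_eq_lintegral_ofReal hc.integrable_squareMeasure
      (Eventually.of_forall h3)]
    exact lintegral_congr fun p => (Real.enorm_of_nonneg (h3 p)).symm
  exact lt_of_not_ge fun h5 => (ENNReal.ofReal_le_ofReal h5).not_gt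
    (h1.trans_le ((lintegral_mono_set hQ).trans_eq h4.symm))

lemma phiB_sub_fFun (a₁ a₂ a₃ β ω ξ η : ℝ) :
    phiB a₃ β ω - fFun a₁ a₂ ξ η ω
      = gB a₁ a₂ a₃ β ω - (cos ξ / sin (ω * a₁) + cos η / sin (ω * a₂)) := by
  rw [fFun, gB]
  ring

lemma IB_eq_symbolIntegral (a₁ a₂ a₃ β ω : ℝ) :
    IB a₁ a₂ a₃ β ω = 1 / (4 * π ^ 2) *
      symbolIntegral (sin (ω * a₁)) (sin (ω * a₂)) (gB a₁ a₂ a₃ β ω) (phiB a₃ β ω) := by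
  simp only [IB, symbolIntegral, squareMeasure, phiB_sub_fFun]

lemma Dfun_eq {a₁ a₂ a₃ β ω : ℝ} (k₁ k₂ : ℝ) (h₁ : sin (ω * a₁) ≠ 0) (h₂ : sin (ω * a₂) ≠ 0)
    (h₃ : sin (ω * a₃) ≠ 0) :
    Dfun a₁ a₂ a₃ β ω k₁ k₂ = sin (ω * a₁) * sin (ω * a₂) * sin (ω * a₃) *
      (gB a₁ a₂ a₃ β ω - (cos k₁ / sin (ω * a₁) + cos k₂ / sin (ω * a₂))) := by
  simp only [Dfun, gB, phiB]
  field_simp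
  ring

lemma abs_cos_div_sin_lt {x : ℝ} (h : sin x ≠ 0) : |cos x / sin x| < 1 / |sin x| := by
  rw [abs_div]
  have : |cos x| < 1 := by
    rw [← sq_lt_one_iff_abs_lt_one]
    have := sin_sq_add_cos_sq x
    have := pow_pos (abs_pos.2 h) 2
    rw [sq_abs] at this
    linarith
  have := abs_pos.2 h
  gcongr

/-- Outside the dispersion set the constant `g` exceeds the range of the symbol. -/
lemma lt_abs_gB_of_notMem_dispSet {a₁ a₂ a₃ β ω : ℝ} (hω : 0 < ω) (hD : ω ∉ dispSet a₁ a₂ a₃ β)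
    (h₁ : sin (ω * a₁) ≠ 0) (h₂ : sin (ω * a₂) ≠ 0) (h₃ : sin (ω * a₃) ≠ 0) :
    1 / |sin (ω * a₁)| + 1 / |sin (ω * a₂)| < |gB a₁ a₂ a₃ β ω| := by
  by_contra! hle
  refine hD ⟨hω, ?_⟩
  set g := gB a₁ a₂ a₃ β ω with hg
  set A := 1 / |sin (ω * a₁)| + 1 / |sin (ω * a₂)| with hA
  have hA0 : 0 < A := by positivity
  have hcos (x : ℝ) (hx : x ≠ 0) :
      ∃ k ∈ Icc (0 : ℝ) π, cos k / x = g / A * (1 / |x|) := by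
    have hbd : |g / A * (x / |x|)| ≤ 1 := by
      rw [abs_mul, abs_div, abs_div, abs_abs, div_self (abs_ne_zero.2 hx), mul_one,
        abs_of_pos hA0]
      exact (div_le_one hA0).2 hle
    refine ⟨arccos (g / A * (x / |x|)), ⟨arccos_nonneg _, arccos_le_pi _⟩, ?_⟩
    rw [cos_arccos (abs_le.1 hbd).1 (abs_le.1 hbd).2]
    field_simp
  obtain ⟨k₁, hk₁, e₁⟩ := hcos _ h₁
  obtain ⟨k₂, hk₂, e₂⟩ := hcos _ h₂
  refine ⟨k₁, hk₁, k₂, hk₂, ?_⟩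
  rw [Dfun_eq k₁ k₂ h₁ h₂ h₃, e₁, e₂, ← mul_add, ← hA, div_mul_cancel₀ _ hA0.ne', sub_self,
    mul_zero]

lemma phiB_div_symbol_nonneg {a₁ a₂ a₃ β ω : ℝ}
    (hgap : 1 / |sin (ω * a₁)| + 1 / |sin (ω * a₂)| < |gB a₁ a₂ a₃ β ω|) (p : ℝ × ℝ) :
    0 ≤ phiB a₃ β ω /
      (gB a₁ a₂ a₃ β ω - (cos p.1 / sin (ω * a₁) + cos p.2 / sin (ω * a₂))) := by
  have hφ : phiB a₃ β ω = gB a₁ a₂ a₃ β ω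
      - (cos (ω * a₁) / sin (ω * a₁) + cos (ω * a₂) / sin (ω * a₂)) := by
    rw [gB]; ring
  have h1 := abs_le.1
    (abs_cos_div_add_cos_div_le (sin (ω * a₁)) (sin (ω * a₂)) (ω * a₁) (ω * a₂))
  have h2 := abs_le.1 (abs_cos_div_add_cos_div_le (sin (ω * a₁)) (sin (ω * a₂)) p.1 p.2)
  rcases lt_abs.1 hgap with h | h
  · exact div_nonneg (by linarith) (by linarith)
  · exact div_nonneg_of_nonpos (by linarith) (by linarith)

lemma phiB_eq_neg_sin_div {a₃ β ω : ℝ} (hβ : cos β ^ 2 = 1) (h : sin (ω * a₃) ≠ 0) :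
    phiB a₃ β ω = -sin (ω * a₃) / (cos (ω * a₃) + cos β) := by
  have hsq := sin_sq_add_cos_sq (ω * a₃)
  have h0 : cos (ω * a₃) + cos β ≠ 0 := by
    intro h1
    have h2 : cos (ω * a₃) = -cos β := by linarith
    rw [h2, neg_sq, hβ] at hsq
    exact h (pow_eq_zero_iff two_ne_zero |>.1 (by linarith))
  rw [phiB, div_eq_div_iff h h0]
  linear_combination hsq - hβ

lemma exists_IB_eq {a₁ a₂ a₃ β c ω₀ C : ℝ} {S : Set ℝ} (hS : IsPreconnected S)
    [NeBot (𝓝[S] c)] [NeBot (𝓝[S] ω₀)]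
    (h₁ : ∀ ω ∈ S, sin (ω * a₁) ≠ 0) (h₂ : ∀ ω ∈ S, sin (ω * a₂) ≠ 0)
    (h₃ : ∀ ω ∈ S, sin (ω * a₃) ≠ 0)
    (hgap : ∀ ω ∈ S, 1 / |sin (ω * a₁)| + 1 / |sin (ω * a₂)| < |gB a₁ a₂ a₃ β ω|)
    (hc : c ∈ dispSet a₁ a₂ a₃ β) (hc₁ : sin (c * a₁) ≠ 0) (hc₂ : sin (c * a₂) ≠ 0)
    (hω₁ : sin (ω₀ * a₁) ≠ 0) (hω₂ : sin (ω₀ * a₂) ≠ 0) (hω₃ : sin (ω₀ * a₃) = 0)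
    (hω₀ : cos (ω₀ * a₃) ≠ cos β) (hC : 1 < C) :
    ∃ ω ∈ S, IB a₁ a₂ a₃ β ω = C := by
  have hp : 0 < 4 * π ^ 2 := by positivity
  have hsin (a x : ℝ) : Tendsto (fun ω => sin (ω * a)) (𝓝[S] x) (𝓝 (sin (x * a))) :=
    (Continuous.tendsto (by fun_prop) x).mono_left nhdsWithin_le_nhds
  have hcos (a x : ℝ) : Tendsto (fun ω => cos (ω * a)) (𝓝[S] x) (𝓝 (cos (x * a))) :=
    (Continuous.tendsto (by fun_prop) x).mono_left nhdsWithin_le_nhds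
  have hcot {x : ℝ} (hx₁ : sin (x * a₁) ≠ 0) (hx₂ : sin (x * a₂) ≠ 0) :
      Tendsto (fun ω => cos (ω * a₁) / sin (ω * a₁) + cos (ω * a₂) / sin (ω * a₂)) (𝓝[S] x)
        (𝓝 (cos (x * a₁) / sin (x * a₁) + cos (x * a₂) / sin (x * a₂))) :=
    ((hcos a₁ x).div (hsin a₁ x) hx₁).add ((hcos a₂ x).div (hsin a₂ x) hx₂)
  have hφ {x : ℝ} (hx₃ : sin (x * a₃) ≠ 0) :
      Tendsto (phiB a₃ β) (𝓝[S] x) (𝓝 (phiB a₃ β x)) :=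
    ((hcos a₃ x).sub_const _).div (hsin a₃ x) hx₃
  have hcont : ContinuousOn (fun ω => symbolIntegral (sin (ω * a₁)) (sin (ω * a₂))
      (gB a₁ a₂ a₃ β ω) (phiB a₃ β ω)) S :=
    continuousOn_symbolIntegral (fun ω _ => hsin a₁ ω) (fun ω _ => hsin a₂ ω)
      (fun ω hω => (hcot (h₁ ω hω) (h₂ ω hω)).add (hφ (h₃ ω hω))) (fun ω hω => hφ (h₃ ω hω))
      h₁ h₂ hgap
  have hnear : ∀ᶠ ω in 𝓝[S] ω₀, symbolIntegral (sin (ω * a₁)) (sin (ω * a₂))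
      (gB a₁ a₂ a₃ β ω) (phiB a₃ β ω) ≤ 4 * π ^ 2 * C := by
    have hne : ∀ᶠ ω in 𝓝[S] ω₀, phiB a₃ β ω ≠ 0 := by
      filter_upwards [((hcos a₃ ω₀).eventually_ne hω₀), self_mem_nhdsWithin] with ω h hω
      exact div_ne_zero (sub_ne_zero.2 h) (h₃ ω hω)
    have hinv : Tendsto (fun ω => (phiB a₃ β ω)⁻¹) (𝓝[S] ω₀) (𝓝 0) := by
      have := (hsin a₃ ω₀).div ((hcos a₃ ω₀).sub_const (cos β)) (sub_ne_zero.2 hω₀)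
      rw [hω₃, zero_div] at this
      exact this.congr fun ω => (inv_div _ _).symm
    have := tendsto_symbolIntegral_of_inv_tendsto_zero (hsin a₁ ω₀) (hsin a₂ ω₀)
      (hcot hω₁ hω₂) hω₁ hω₂ hne hinv
    exact (this.eventually (gt_mem_nhds (by nlinarith))).mono fun ω h => h.le
  have hcotc : |cos (c * a₁) / sin (c * a₁) + cos (c * a₂) / sin (c * a₂)|
      < 1 / |sin (c * a₁)| + 1 / |sin (c * a₂)| :=
    (abs_add_le _ _).trans_lt (add_lt_add (abs_cos_div_sin_lt hc₁) (abs_cos_div_sin_lt hc₂))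
  have hge {φ₀ : ℝ} (h : Tendsto (phiB a₃ β) (𝓝[S] c) (𝓝 φ₀)) :
      1 / |sin (c * a₁)| + 1 / |sin (c * a₂)|
        ≤ |cos (c * a₁) / sin (c * a₁) + cos (c * a₂) / sin (c * a₂) + φ₀| := by
    refine le_of_tendsto_of_tendsto
      ((tendsto_const_nhds.div (hsin a₁ c).abs (abs_ne_zero.2 hc₁)).add
        (tendsto_const_nhds.div (hsin a₂ c).abs (abs_ne_zero.2 hc₂)))
      ((hcot hc₁ hc₂).add h).abs ?_
    filter_upwards [self_mem_nhdsWithin] with ω hω using (hgap ω hω).le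
  obtain ⟨-, k₁, -, k₂, -, hD⟩ := hc
  have hc₃ : sin (c * a₃) ≠ 0 := by
    intro h0
    have hcβ : cos (c * a₃) = cos β := by
      simpa [Dfun, h0, hc₁, hc₂, sub_eq_zero] using hD
    have hβ : cos β ^ 2 = 1 := by
      have := sin_sq_add_cos_sq (c * a₃)
      rw [h0, hcβ] at this
      linarith
    have hβ0 : cos β ≠ 0 := by
      rintro h
      simp [h] at hβ
    have hlim : Tendsto (phiB a₃ β) (𝓝[S] c) (𝓝 0) := by
      have := (hsin a₃ c).neg.div ((hcos a₃ c).add_const (cos β))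
        (by rw [hcβ]; exact fun h => hβ0 (by linarith))
      rw [h0, neg_zero, zero_div] at this
      refine this.congr' ?_
      filter_upwards [self_mem_nhdsWithin] with ω hω
      exact (phiB_eq_neg_sin_div hβ (h₃ ω hω)).symm
    have := hge hlim
    rw [add_zero] at this
    linarith
  have hedge : |gB a₁ a₂ a₃ β c| = 1 / |sin (c * a₁)| + 1 / |sin (c * a₂)| := by
    refine le_antisymm ?_ (hge (hφ hc₃))
    rw [Dfun_eq k₁ k₂ hc₁ hc₂ hc₃] at hD
    have : gB a₁ a₂ a₃ β c = cos k₁ / sin (c * a₁) + cos k₂ / sin (c * a₂) := by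
      simpa [hc₁, hc₂, hc₃, sub_eq_zero] using hD
    rw [this]
    exact abs_cos_div_add_cos_div_le _ _ _ _
  have hφc : phiB a₃ β c ≠ 0 := by
    intro h
    rw [gB, h, add_zero] at hedge
    linarith
  have hfar := eventually_lt_symbolIntegral (hsin a₁ c) (hsin a₂ c)
    ((hcot hc₁ hc₂).add (hφ hc₃)) (hφ hc₃) hc₁ hc₂ hφc hedge
    (by filter_upwards [self_mem_nhdsWithin] with ω hω using hgap ω hω)
    (by filter_upwards [self_mem_nhdsWithin] with ω hω using phiB_div_symbol_nonneg (hgap ω hω))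
    (4 * π ^ 2 * C)
  obtain ⟨ω, hω, h⟩ := hS.intermediate_value₂_eventually₂ (l₁ := 𝓝[S] ω₀) (l₂ := 𝓝[S] c)
    inf_le_right inf_le_right hcont continuousOn_const hnear (hfar.mono fun ω h => h.le)
  refine ⟨ω, hω, ?_⟩
  rw [IB_eq_symbolIntegral, h]
  field_simp

/-- A frequency with `I_β = 1 / (1 - μ)` outside the spectrum is an eigenfrequency. -/
lemma exists_eigenfunction {a₁ a₂ a₃ β μ ω : ℝ} (hμ : μ < 1)
    (hgap : 1 / |sin (ω * a₁)| + 1 / |sin (ω * a₂)| < |gB a₁ a₂ a₃ β ω|)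
    (hI : IB a₁ a₂ a₃ β ω = (1 - μ)⁻¹) :
    (∃ u : ℤ × ℤ → ℂ, (Summable fun p : ℤ × ℤ => ‖u p‖ ^ 2) ∧ u ≠ 0 ∧
      SatisfiesFD a₁ a₂ a₃ β μ ω u) ∧ μ = 1 - FB a₁ a₂ a₃ β ω := by
  refine ⟨?_, by rw [FB, hI, inv_inv]; ring⟩
  obtain ⟨u, hsum, hu0, hu⟩ := exists_green_function hgap
  have hμ' : 1 - μ ≠ 0 := (sub_pos.2 hμ).ne'
  have hI2 : (1 - μ) * (phiB a₃ β ω * ∫ p, (gB a₁ a₂ a₃ β ω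
      - (cos p.1 / sin (ω * a₁) + cos p.2 / sin (ω * a₂)))⁻¹ ∂squareMeasure) = 4 * π ^ 2 := by
    rw [IB_eq_symbolIntegral, symbolIntegral] at hI
    simp only [div_eq_mul_inv (phiB a₃ β ω)] at hI
    rw [integral_const_mul] at hI
    have hp := Real.pi_pos.ne'
    field_simp at hI ⊢
    linarith
  refine ⟨u, hsum, ?_, fun k l hkl => ?_, ?_⟩
  · rintro rfl
    have : (∫ p, (gB a₁ a₂ a₃ β ω
      - (cos p.1 / sin (ω * a₁) + cos p.2 / sin (ω * a₂)))⁻¹ ∂squareMeasure) = 0 := by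
      exact Complex.ofReal_eq_zero.1 hu0.symm
    rw [this, mul_zero, mul_zero] at hI2
    have hp : (0 : ℝ) < 4 * π ^ 2 := by positivity
    exact hp.ne hI2
  · rw [hu k l, if_neg hkl]
  · have h := hu 0 0
    rw [if_pos rfl, zero_add, zero_sub] at h
    rw [h, hu0]
    have := congrArg (fun x : ℝ => (x : ℂ)) hI2
    push_cast at this ⊢
    linear_combination 2 * this

lemma mem_dispSet_of_sin_eq_zero {a₁ a₂ a₃ β ω : ℝ} (hω : 0 < ω)
    (h : sin (ω * a₁) = 0 ∨ sin (ω * a₂) = 0 ∨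
      (sin (ω * a₃) = 0 ∧ cos (ω * a₃) = cos β)) : ω ∈ dispSet a₁ a₂ a₃ β := by
  have harc (x : ℝ) : arccos (cos x) ∈ Icc (0 : ℝ) π := ⟨arccos_nonneg _, arccos_le_pi _⟩
  refine ⟨hω, _, harc (ω * a₁), _, harc (ω * a₂), ?_⟩
  have hc (x : ℝ) : cos (arccos (cos x)) = cos x := cos_arccos (neg_one_le_cos x) (cos_le_one x)
  rw [Dfun, hc, hc]
  rcases h with h | h | ⟨-, h⟩ <;> simp [h]

lemma exists_nat_of_sin_mul_eq_zero {x a : ℝ} (hx : 0 < x) (ha : 0 < a) (h : sin (x * a) = 0) :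
    ∃ n : ℕ, 1 ≤ n ∧ x = π * n / a := by
  obtain ⟨n, hn⟩ := sin_eq_zero_iff.1 h
  have hn0 : 0 < n := by
    have : 0 < (n : ℝ) * π := hn ▸ mul_pos hx ha
    exact_mod_cast pos_of_mul_pos_left this Real.pi_pos.le
  lift n to ℕ using hn0.le
  refine ⟨n, by omega, ?_⟩
  push_cast at hn
  field_simp
  linarith

lemma sin_mul_ne_zero_of_notMem_Tset {a₁ a₂ x : ℝ} (ha₁ : 0 < a₁) (ha₂ : 0 < a₂) (hx : 0 < x)
    (h : x ∉ Tset a₁ a₂) : sin (x * a₁) ≠ 0 ∧ sin (x * a₂) ≠ 0 :=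
  ⟨fun h1 => h (.inl (exists_nat_of_sin_mul_eq_zero hx ha₁ h1)),
    fun h2 => h (.inr (exists_nat_of_sin_mul_eq_zero hx ha₂ h2))⟩

lemma sin_mul_eq_zero_of_mem_Wset {a₃ β ω : ℝ} (ha₃ : 0 < a₃) (h : ω ∈ Wset a₃ β) :
    sin (ω * a₃) = 0 := by
  rw [Wset] at h
  split_ifs at h with hβ
  · obtain ⟨n, -, rfl⟩ := h
    rw [← add_div, div_mul_cancel₀ _ ha₃.ne']
    rcases hβ with rfl | rfl
    · exact sin_eq_zero_iff.2 ⟨2 * n + 1, by push_cast; ring⟩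
    · exact sin_eq_zero_iff.2 ⟨2 * n + 2, by push_cast; ring⟩
  · obtain ⟨n, -, rfl⟩ := h
    rw [div_mul_cancel₀ _ ha₃.ne', mul_comm]
    exact sin_nat_mul_pi n

/-- Consecutive zeros of `sin (z a)` alternate between `cos (z a) = 1` and `cos (z a) = -1`. -/
lemma exists_sin_eq_zero_cos_eq {a β x y : ℝ} (ha : 0 < a) (hβ : β = 0 ∨ β = π) (hxy : x < y)
    (hx : sin (x * a) = 0) (hy : sin (y * a) = 0) :
    ∃ z ∈ Icc x y, sin (z * a) = 0 ∧ cos (z * a) = cos β := by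
  by_cases hxβ : cos (x * a) = cos β
  · exact ⟨x, ⟨le_rfl, hxy.le⟩, hx, hxβ⟩
  obtain ⟨m, hm⟩ := sin_eq_zero_iff.1 hx
  obtain ⟨n, hn⟩ := sin_eq_zero_iff.1 hy
  have hp := Real.pi_pos
  have hmn : m < n := by
    have h1 : (m : ℝ) * π < n * π := by rw [hm, hn]; gcongr
    exact_mod_cast lt_of_mul_lt_mul_right h1 hp.le
  have hmn' : ((m : ℝ) + 1) ≤ n := by exact_mod_cast hmn
  have hz : (x + π / a) * a = x * a + π := by field_simp
  refine ⟨x + π / a, ⟨by simpa using (div_pos hp ha).le, ?_⟩, ?_, ?_⟩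
  · rw [← mul_le_mul_iff_left₀ ha, hz, ← hm, ← hn]
    nlinarith
  · rw [hz, sin_add_pi, hx, neg_zero]
  · rw [hz, cos_add_pi]
    have h1 : cos (x * a) = 1 ∨ cos (x * a) = -1 := by
      rw [← sq_eq_one_iff]
      have := sin_sq_add_cos_sq (x * a)
      rw [hx] at this
      linarith
    rcases hβ with rfl | rfl <;> rcases h1 with h1 | h1 <;> simp_all

/-- for `0 < μ < 1`, a gap of type (i) contains at least two
eigenvalues, one on each side of `ω₀`. -/
theorem stmt14 (a₁ a₂ a₃ β μ : ℝ) (ha₁ : 0 < a₁) (ha₂ : 0 < a₂) (ha₃ : 0 < a₃)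
    (hβ : β ∈ Icc (0 : ℝ) π) (hμ0 : 0 < μ) (hμ1 : μ < 1)
    (ωb ωt ω₀ : ℝ) (hgap : IsGap a₁ a₂ a₃ β ωb ωt)
    (hb : ωb ∉ Tset a₁ a₂) (ht : ωt ∉ Tset a₁ a₂)
    (hω₀ : ω₀ ∈ Ioo ωb ωt ∩ Wset a₃ β)
    (huniq : ∀ ω ∈ Ioo ωb ωt ∩ Wset a₃ β, ω = ω₀) :
    ∃ ω₁ ∈ Ioo ωb ω₀, ∃ ω₂ ∈ Ioo ω₀ ωt,
      (∃ u : ℤ × ℤ → ℂ, (Summable fun p : ℤ × ℤ => ‖u p‖ ^ 2) ∧ u ≠ 0 ∧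
          SatisfiesFD a₁ a₂ a₃ β μ ω₁ u) ∧
      μ = 1 - FB a₁ a₂ a₃ β ω₁ ∧
      (∃ u : ℤ × ℤ → ℂ, (Summable fun p : ℤ × ℤ => ‖u p‖ ^ 2) ∧ u ≠ 0 ∧
          SatisfiesFD a₁ a₂ a₃ β μ ω₂ u) ∧
      μ = 1 - FB a₁ a₂ a₃ β ω₂ := by
  obtain ⟨hb0, hbt, hbS, htS, hempty⟩ := hgap
  obtain ⟨⟨hbω, hωt⟩, hW⟩ := hω₀
  have hnot {ω : ℝ} (h : ω ∈ Ioo ωb ωt) : ω ∉ dispSet a₁ a₂ a₃ β :=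
    fun h' => (eq_empty_iff_forall_notMem.1 hempty) ω ⟨h, h'⟩
  have hpos {ω : ℝ} (h : ω ∈ Ioo ωb ωt) : 0 < ω := hb0.trans h.1
  have h₁ {ω : ℝ} (h : ω ∈ Ioo ωb ωt) : sin (ω * a₁) ≠ 0 :=
    fun h' => hnot h (mem_dispSet_of_sin_eq_zero (hpos h) (.inl h'))
  have h₂ {ω : ℝ} (h : ω ∈ Ioo ωb ωt) : sin (ω * a₂) ≠ 0 :=
    fun h' => hnot h (mem_dispSet_of_sin_eq_zero (hpos h) (.inr (.inl h')))
  have hsin₀ := sin_mul_eq_zero_of_mem_Wset ha₃ hW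
  have hcos₀ : cos (ω₀ * a₃) ≠ cos β :=
    fun h => hnot ⟨hbω, hωt⟩ (mem_dispSet_of_sin_eq_zero (hb0.trans hbω) (.inr (.inr ⟨hsin₀, h⟩)))
  have h₃ {ω : ℝ} (h : ω ∈ Ioo ωb ωt) (hne : ω ≠ ω₀) : sin (ω * a₃) ≠ 0 := by
    intro h0
    by_cases hβ' : β = 0 ∨ β = π
    · have hbetween {x y : ℝ} (hxy : x < y) (hx : x ∈ Ioo ωb ωt) (hy : y ∈ Ioo ωb ωt)
          (hsx : sin (x * a₃) = 0) (hsy : sin (y * a₃) = 0) : False := by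
        obtain ⟨z, hz, hzβ⟩ := exists_sin_eq_zero_cos_eq ha₃ hβ' hxy hsx hsy
        have hzI : z ∈ Ioo ωb ωt := ⟨hx.1.trans_le hz.1, hz.2.trans_lt hy.2⟩
        exact hnot hzI (mem_dispSet_of_sin_eq_zero (hpos hzI) (.inr (.inr hzβ)))
      rcases hne.lt_or_gt with hlt | hlt
      · exact hbetween hlt h ⟨hbω, hωt⟩ h0 hsin₀
      · exact hbetween hlt ⟨hbω, hωt⟩ h hsin₀ h0
    · refine hne (huniq ω ⟨h, ?_⟩)
      rw [Wset, if_neg hβ']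
      exact exists_nat_of_sin_mul_eq_zero (hpos h) ha₃ h0
  have hgap {ω : ℝ} (h : ω ∈ Ioo ωb ωt) (hne : ω ≠ ω₀) :
      1 / |sin (ω * a₁)| + 1 / |sin (ω * a₂)| < |gB a₁ a₂ a₃ β ω| :=
    lt_abs_gB_of_notMem_dispSet (hpos h) (hnot h) (h₁ h) (h₂ h) (h₃ h hne)
  have hC : 1 < (1 - μ)⁻¹ := (one_lt_inv₀ (by linarith)).2 (by linarith)
  have hsolve {S : Set ℝ} {c : ℝ} (hS : IsPreconnected S) (hScl : c ∈ closure S)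
      (hScl₀ : ω₀ ∈ closure S) (hsub : S ⊆ Ioo ωb ωt) (hS₀ : ω₀ ∉ S)
      (hc : c ∈ dispSet a₁ a₂ a₃ β) (hcT : c ∉ Tset a₁ a₂) :
      ∃ ω ∈ S, (∃ u : ℤ × ℤ → ℂ, (Summable fun p : ℤ × ℤ => ‖u p‖ ^ 2) ∧ u ≠ 0 ∧
        SatisfiesFD a₁ a₂ a₃ β μ ω u) ∧ μ = 1 - FB a₁ a₂ a₃ β ω := by
    have hne {ω : ℝ} (h : ω ∈ S) : ω ≠ ω₀ := fun h' => hS₀ (h' ▸ h)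
    have := mem_closure_iff_nhdsWithin_neBot.1 hScl
    have := mem_closure_iff_nhdsWithin_neBot.1 hScl₀
    have hsc := sin_mul_ne_zero_of_notMem_Tset ha₁ ha₂ hc.1 hcT
    obtain ⟨ω, hω, hI⟩ := exists_IB_eq hS (fun ω h => h₁ (hsub h)) (fun ω h => h₂ (hsub h))
      (fun ω h => h₃ (hsub h) (hne h)) (fun ω h => hgap (hsub h) (hne h)) hc hsc.1 hsc.2
      (h₁ ⟨hbω, hωt⟩) (h₂ ⟨hbω, hωt⟩) hsin₀ hcos₀ hC
    exact ⟨ω, hω, exists_eigenfunction hμ1 (hgap (hsub hω) (hne hω)) hI⟩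
  obtain ⟨ω₁, hω₁, hu₁, hF₁⟩ := hsolve (S := Ioo ωb ω₀) isPreconnected_Ioo
    (by rw [closure_Ioo hbω.ne]; exact left_mem_Icc.2 hbω.le)
    (by rw [closure_Ioo hbω.ne]; exact right_mem_Icc.2 hbω.le)
    (Ioo_subset_Ioo_right hωt.le) (fun h => h.2.false) hbS hb
  obtain ⟨ω₂, hω₂, hu₂, hF₂⟩ := hsolve (S := Ioo ω₀ ωt) isPreconnected_Ioo
    (by rw [closure_Ioo hωt.ne]; exact right_mem_Icc.2 hωt.le)
    (by rw [closure_Ioo hωt.ne]; exact left_mem_Icc.2 hωt.le)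
    (Ioo_subset_Ioo_left hbω.le) (fun h => h.1.false) htS ht
  exact ⟨ω₁, hω₁, ω₂, hω₂, hu₁, hF₁, hu₂, hF₂⟩
end
end
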